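/- Up to equivalence, there is a unique binary self-dual [44,22,8] code having an automorphism of odd prime order whose weight enumerator is W_{44,1} with β = 122, i.e., with exactly 44 + 4·122 = 532 codewords of weight 8 and exactly 976 − 8·122 = 0 codewords of weight 10; moreover, its automorphism group has order 3251404800 = 2^15 · 3^4 · 5^2 · 7^2. -/

import Mathlib

namespace SD

variable {ι : Type*}

/-- The (Hamming) weight of a binary vector. -/
def wt [Fintype ι] (v : ι → ZMod 2) : ℕ := (Finset.univ.filter fun i => v i ≠ 0).card

/-- A binary code (subspace of `F_2^ι`) is self-dual if it coincides with its dual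
under the standard inner product. -/
def isSelfDual [Fintype ι] (Code : Submodule (ZMod 2) (ι → ZMod 2)) : Prop :=
  ∀ u : ι → ZMod 2, u ∈ Code ↔ ∀ v ∈ Code, ∑ i, u i * v i = 0

/-- The linear map permuting coordinates of vectors by `σ`. -/
def permLM (σ : Equiv.Perm ι) : (ι → ZMod 2) →ₗ[ZMod 2] (ι → ZMod 2) where
  toFun v := v ∘ σ
  map_add' _ _ := rfl
  map_smul' _ _ := rfl

/-- The image of a code under a coordinate permutation. -/
def permCode (σ : Equiv.Perm ι) (Code : Submodule (ZMod 2) (ι → ZMod 2)) :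
    Submodule (ZMod 2) (ι → ZMod 2) := Submodule.map (permLM σ) Code

/-- Two binary codes are equivalent if a coordinate permutation maps one onto the other. -/
def codeEquiv (C D : Submodule (ZMod 2) (ι → ZMod 2)) : Prop :=
  ∃ σ : Equiv.Perm ι, permCode σ C = D

/-- The code has minimum weight (exactly) `d`. -/
def minWtEq [Fintype ι] (Code : Submodule (ZMod 2) (ι → ZMod 2)) (d : ℕ) : Prop :=
  (∀ v ∈ Code, v ≠ 0 → d ≤ wt v) ∧ ∃ v ∈ Code, v ≠ 0 ∧ wt v = d

/-- An automorphism of type `p-(c,f)` of a code of length `n`: order `p`, exactly `f`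
fixed points (hence exactly `c` independent `p`-cycles, as `n = p*c + f`). -/
def autOfType {n : ℕ} (σ : Equiv.Perm (Fin n)) (p c f : ℕ) : Prop :=
  orderOf σ = p ∧ (Finset.univ.filter fun i => σ i = i).card = f ∧ n = p * c + f

/-- A binary self-dual [44,22,8] code with an automorphism of odd prime order and
weight enumerator W_{44,1}, β = 122: exactly 532 codewords of weight 8 and 0 of weight 10. -/
def targetCode (Code : Submodule (ZMod 2) (Fin 44 → ZMod 2)) : Prop :=
  isSelfDual Code ∧ Module.finrank (ZMod 2) Code = 22 ∧ minWtEq Code 8 ∧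
  (∃ p : ℕ, p.Prime ∧ Odd p ∧
    ∃ σ : Equiv.Perm (Fin 44), permCode σ Code = Code ∧ orderOf σ = p) ∧
  Nat.card {v : Fin 44 → ZMod 2 // v ∈ Code ∧ wt v = 8} = 532 ∧
  Nat.card {v : Fin 44 → ZMod 2 // v ∈ Code ∧ wt v = 10} = 0

section Characters

open Finset Polynomial
open scoped symmDiff

variable {α : Type*} [DecidableEq α]

/-- The binary character `(-1)^{|J ∩ c|}` of the space of finite sets. -/
def chi (J c : Finset α) : ℤ := (-1) ^ (J ∩ c).card

/-- The value at `w` of the binary Krawtchouk polynomial of length `n` and degree `j`. -/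
def kraw (n j w : ℕ) : ℤ :=
  ∑ i ∈ range (j + 1), (-1) ^ i * (w.choose i : ℤ) * ((n - w).choose (j - i) : ℤ)

lemma chi_eq_prod (J c : Finset α) : chi J c = ∏ i ∈ J, if i ∈ c then (-1 : ℤ) else 1 := by
  rw [prod_ite, prod_const, prod_const_one, mul_one, filter_mem_eq_inter, chi]

lemma coeff_one_sub_X_pow (w i : ℕ) :
    (((1 - X : ℤ[X])) ^ w).coeff i = (-1) ^ i * (w.choose i : ℤ) := by
  have h : ((1 - X : ℤ[X])) ^ w = ((1 + X : ℤ[X]) ^ w).comp (C (-1) * X) := by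
    simp [sub_eq_add_neg]
  rw [h, comp_C_mul_X_coeff, coeff_one_add_X_pow, mul_comm]

lemma sum_chi_powersetCard (R c : Finset α) (j : ℕ) :
    ∑ J ∈ R.powersetCard j, chi J c = kraw R.card j (R ∩ c).card := by
  have h1 : ∏ i ∈ R, (1 + C (if i ∈ c then (-1 : ℤ) else 1) * X) =
      ∑ J ∈ R.powerset, C (chi J c) * X ^ J.card := by
    rw [prod_one_add]
    refine sum_congr rfl fun J _ => ?_
    rw [prod_mul_distrib, prod_const, chi_eq_prod, map_prod]
  have h2 : ∏ i ∈ R, (1 + C (if i ∈ c then (-1 : ℤ) else 1) * X) =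
      (1 - X) ^ (R ∩ c).card * (1 + X) ^ (R.card - (R ∩ c).card) := by
    rw [← prod_filter_mul_prod_filter_not R (· ∈ c), filter_mem_eq_inter]
    congr 1
    · rw [prod_congr rfl (g := fun _ => (1 - X : ℤ[X])), prod_const]
      intro i hi
      simp [(mem_inter.1 hi).2, sub_eq_add_neg]
    · rw [prod_congr rfl (g := fun _ => (1 + X : ℤ[X])), prod_const]
      · congr 1
        have := card_filter_add_card_filter_not (s := R) (· ∈ c)
        rw [filter_mem_eq_inter] at this
        omega
      · intro i hi
        simp [(mem_filter.1 hi).2]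
  have h3 := congrArg (fun p => p.coeff j) (h1.symm.trans h2)
  simp only [finsetSum_coeff, coeff_C_mul, coeff_X_pow, mul_ite, mul_one, mul_zero] at h3
  rw [← sum_filter] at h3
  rw [powersetCard_eq_filter]
  simp only [eq_comm (a := j)] at h3
  rw [h3, coeff_mul, Finset.Nat.sum_antidiagonal_eq_sum_range_succ_mk]
  refine sum_congr rfl fun i _ => ?_
  rw [coeff_one_sub_X_pow, coeff_one_add_X_pow]

lemma card_symmDiff_add (J K : Finset α) :
    (J ∆ K).card + 2 * (J ∩ K).card = J.card + K.card := by
  have h1 : (J ∆ K).card = (J \ K).card + (K \ J).card := by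
    rw [symmDiff_def, sup_eq_union, card_union_of_disjoint disjoint_sdiff_sdiff]
  have h2 := card_sdiff_add_card_inter J K
  have h3 := card_sdiff_add_card_inter K J
  rw [inter_comm K J] at h3
  omega

lemma chi_comm (J c : Finset α) : chi J c = chi c J := by
  rw [chi, chi, inter_comm]

lemma chi_symmDiff (J K c : Finset α) : chi (J ∆ K) c = chi J c * chi K c := by
  have h : (J ∆ K) ∩ c = (J ∩ c) ∆ (K ∩ c) := inf_symmDiff_distrib_right J K c
  have := card_symmDiff_add (J ∩ c) (K ∩ c)
  rw [chi, chi, chi, ← pow_add, ← this, pow_add, pow_mul, h]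
  simp

lemma chi_union {J K : Finset α} (h : Disjoint J K) (c : Finset α) :
    chi (J ∪ K) c = chi J c * chi K c := by
  rw [← chi_symmDiff, h.symmDiff_eq_sup, sup_eq_union]

lemma chi_eq_one_iff (J c : Finset α) : chi J c = 1 ↔ Even (J ∩ c).card := by
  rw [chi]
  rcases Nat.even_or_odd (J ∩ c).card with h | h
  · simp [h]
  · simp [h.neg_one_pow, Nat.not_even_iff_odd.2 h]

lemma chi_singleton (p : α) (c : Finset α) : chi {p} c = if p ∈ c then -1 else 1 := by
  rw [chi_eq_prod, prod_singleton]

/-- A family of sets whose indicator vectors form a self-dual binary code. -/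
def SelfDual (C : Finset (Finset α)) : Prop := ∀ J, J ∈ C ↔ ∀ c ∈ C, Even (J ∩ c).card

variable {C : Finset (Finset α)}

lemma SelfDual.symmDiff_mem (hC : SelfDual C) {J K : Finset α} (hJ : J ∈ C) (hK : K ∈ C) :
    J ∆ K ∈ C := by
  refine (hC _).2 fun c hc => ?_
  rw [← chi_eq_one_iff, chi_symmDiff, (chi_eq_one_iff _ _).2 ((hC J).1 hJ c hc),
    (chi_eq_one_iff _ _).2 ((hC K).1 hK c hc), one_mul]

lemma SelfDual.even_card (hC : SelfDual C) {J : Finset α} (hJ : J ∈ C) : Even J.card := by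
  simpa using (hC J).1 hJ J hJ

lemma SelfDual.empty_mem (hC : SelfDual C) : ∅ ∈ C := (hC _).2 (by simp)

lemma SelfDual.sum_character (hC : SelfDual C) {ψ : Finset α → ℤ}
    (hψ : ∀ c ∈ C, ∀ d ∈ C, ψ (c ∆ d) = ψ c * ψ d) {d : Finset α} (hd : d ∈ C) (hne : ψ d ≠ 1) :
    ∑ c ∈ C, ψ c = 0 := by
  have h : ∑ c ∈ C, ψ c = ∑ c ∈ C, ψ c * ψ d := by
    refine sum_nbij' (· ∆ d) (· ∆ d) (fun c hc => hC.symmDiff_mem hc hd)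
      (fun c hc => hC.symmDiff_mem hc hd) (by simp) (by simp) fun c hc => ?_
    rw [← hψ _ (hC.symmDiff_mem hc hd) _ hd, symmDiff_symmDiff_cancel_right]
  rw [← sum_mul] at h
  have h' : (∑ c ∈ C, ψ c) * (ψ d - 1) = 0 := by linarith
  exact (mul_eq_zero.1 h').resolve_right (sub_ne_zero.2 hne)

lemma SelfDual.sum_chi (hC : SelfDual C) (J : Finset α) :
    ∑ c ∈ C, chi J c = if J ∈ C then (C.card : ℤ) else 0 := by
  split_ifs with h
  · rw [sum_congr rfl fun c hc => (chi_eq_one_iff J c).2 ((hC J).1 h c hc)]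
    simp
  · rw [hC J] at h
    push Not at h
    obtain ⟨d, hd, hodd⟩ := h
    refine hC.sum_character (fun c _ d _ => ?_) hd (mt (chi_eq_one_iff J d).1 hodd)
    rw [chi_comm, chi_symmDiff, chi_comm c, chi_comm d]

/-- The character `(-1)^{|c|/2}` of a self-dual code. -/
def halfSign (c : Finset α) : ℤ := (-1) ^ (c.card / 2)

lemma SelfDual.halfSign_symmDiff (hC : SelfDual C) {c d : Finset α} (hc : c ∈ C) (hd : d ∈ C) :
    halfSign (c ∆ d) = halfSign c * halfSign d := by
  obtain ⟨i, hi⟩ := (hC c).1 hc d hd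
  obtain ⟨j, hj⟩ := hC.even_card hc
  obtain ⟨k, hk⟩ := hC.even_card hd
  obtain ⟨l, hl⟩ := hC.even_card (hC.symmDiff_mem hc hd)
  have := card_symmDiff_add c d
  have e : (c ∆ d).card / 2 + 2 * (2 * i) / 2 = c.card / 2 + d.card / 2 := by omega
  have e' : 2 * (2 * i) / 2 = i + i := by omega
  rw [halfSign, halfSign, halfSign, ← pow_add, ← e, e', pow_add, (Even.add_self i).neg_one_pow,
    mul_one]

end Characters

section Extremal

open Finset
open scoped symmDiff

/-- The set-theoretic form of a self-dual `[44, 22, 8]` code with 532 words of weight 8 and none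
of weight 10. -/
structure IsTarget (C : Finset (Finset (Fin 44))) : Prop where
  selfDual : SelfDual C
  card_eq : C.card = 2 ^ 22
  eight_le : ∀ c ∈ C, c ≠ ∅ → 8 ≤ c.card
  card_eight : {c ∈ C | c.card = 8}.card = 532
  ne_ten : ∀ c ∈ C, c.card ≠ 10

variable {C : Finset (Finset (Fin 44))}

lemma SelfDual.compl_mem (hC : SelfDual C) {c : Finset (Fin 44)} (hc : c ∈ C) : cᶜ ∈ C := by
  have h : (univ : Finset (Fin 44)) ∈ C :=
    (hC _).2 fun d hd => by simpa using hC.even_card hd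
  have := hC.symmDiff_mem h hc
  rwa [← top_eq_univ, top_symmDiff, hnot_eq_compl] at this

lemma card_compl_add (c : Finset (Fin 44)) : cᶜ.card + c.card = 44 := by
  simp

lemma SelfDual.card_filter_compl (hC : SelfDual C) {i j : ℕ} (hij : i + j = 44) :
    {c ∈ C | c.card = i}.card = {c ∈ C | c.card = j}.card := by
  refine card_nbij' compl compl ?_ ?_ (fun c _ => compl_compl c) fun c _ => compl_compl c
  all_goals
    intro c hc
    simp only [coe_filter, Set.mem_ofPred_eq] at hc ⊢
    have := card_compl_add c
    exact ⟨hC.compl_mem hc.1, by omega⟩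

namespace IsTarget

lemma card_cases (hC : IsTarget C) {c : Finset (Fin 44)} (hc : c ∈ C) :
    c.card ∈ [0, 8, 12, 14, 16, 18, 20, 22, 24, 26, 28, 30, 32, 36, 44] := by
  have h1 : c.card = 0 ∨ 8 ≤ c.card := by
    by_cases h : c = ∅
    · simp [h]
    · exact Or.inr (hC.eight_le c hc h)
  have hc' := hC.selfDual.compl_mem hc
  have h2 : cᶜ.card = 0 ∨ 8 ≤ cᶜ.card := by
    by_cases h : cᶜ = ∅
    · simp [h]
    · exact Or.inr (hC.eight_le _ hc' h)
  have h3 := hC.ne_ten c hc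
  have h4 := hC.ne_ten _ hc'
  have h5 := card_compl_add c
  obtain ⟨k, hk⟩ := hC.selfDual.even_card hc
  simp only [List.mem_cons, List.not_mem_nil, or_false]
  omega

lemma eq_empty_of_card_lt (hC : IsTarget C) {c : Finset (Fin 44)} (hc : c ∈ C)
    (h : c.card < 8) : c = ∅ := by
  by_contra hne
  have := hC.eight_le c hc hne
  omega

end IsTarget

lemma kraw_certificate_weights :
    ∀ w ∈ [0, 8, 12, 14, 16, 18, 20, 22, 24, 26, 28, 30, 32, 36, 44],
      1320 * kraw 44 0 w + 381 * kraw 44 2 w + 82 * kraw 44 4 w + 8 * kraw 44 6 w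
        - 2 * kraw 44 8 w - kraw 44 10 w - 512 * ((-1) ^ (w / 2) * kraw 44 2 w) =
      -2768240640 * ((if w = 0 then 1 else 0) + (if w = 44 then 1 else 0)) +
      4194304 * ((if w = 8 then 1 else 0) + (if w = 36 then 1 else 0)) := by
  simp only [kraw, Nat.choose_eq_descFactorial_div_factorial]
  decide +kernel

lemma SelfDual.sum_kraw (hC : SelfDual C) (j : ℕ) :
    ∑ c ∈ C, kraw 44 j c.card = C.card * {c ∈ C | c.card = j}.card := by
  have h (c : Finset (Fin 44)) : kraw 44 j c.card = ∑ J ∈ univ.powersetCard j, chi J c := by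
    rw [sum_chi_powersetCard, univ_inter, card_univ, Fintype.card_fin]
  simp_rw [h]
  rw [sum_comm]
  simp_rw [hC.sum_chi]
  rw [← sum_filter, sum_const, nsmul_eq_mul, mul_comm]
  congr 3
  ext J
  simp [and_comm]

lemma SelfDual.sum_halfSign_kraw (hC : SelfDual C)
    (h : ∀ J : Finset (Fin 44), J.card = 2 → ∃ c ∈ C, halfSign c ≠ chi J c) :
    ∑ c ∈ C, halfSign c * kraw 44 2 c.card = 0 := by
  have h' (c : Finset (Fin 44)) : halfSign c * kraw 44 2 c.card =
      ∑ J ∈ univ.powersetCard 2, halfSign c * chi J c := by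
    rw [← mul_sum, sum_chi_powersetCard, univ_inter, card_univ, Fintype.card_fin]
  simp_rw [h']
  rw [sum_comm]
  refine sum_eq_zero fun J hJ => ?_
  obtain ⟨d, hd, hne⟩ := h J (mem_powersetCard_univ.1 hJ)
  refine hC.sum_character (fun c hc d hd => ?_) hd fun h1 => hne ?_
  · rw [hC.halfSign_symmDiff hc hd, chi_comm, chi_symmDiff, chi_comm c, chi_comm d]
    ring
  · have hsq : halfSign d * halfSign d = 1 := by
      rw [halfSign, ← pow_add, (Even.add_self _).neg_one_pow]
    calc halfSign d = halfSign d * (halfSign d * chi J d) := by rw [h1, mul_one]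
      _ = chi J d := by rw [← mul_assoc, hsq, one_mul]

lemma IsTarget.exists_shadow_pair (hC : IsTarget C) :
    ∃ a b : Fin 44, a ≠ b ∧ ∀ c ∈ C, halfSign c = chi {a, b} c := by
  by_contra hcon
  have h0 := hC.selfDual.sum_halfSign_kraw fun J hJ => by
    obtain ⟨a, b, hab, rfl⟩ := card_eq_two.1 hJ
    by_contra hne
    push Not at hne
    exact hcon ⟨a, b, hab, hne⟩
  have e (j : ℕ) (hj : j ∈ [2, 4, 6, 10]) : {c ∈ C | c.card = j}.card = 0 := by
    rw [card_eq_zero, filter_eq_empty_iff]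
    rintro c hc rfl
    have := hC.card_cases hc
    simp only [List.mem_cons, List.not_mem_nil, or_false] at this hj
    omega
  have e0 : {c ∈ C | c.card = 0}.card = 1 := by
    rw [card_eq_one]
    refine ⟨∅, ?_⟩
    ext c
    simp only [card_eq_zero, mem_filter, mem_singleton, and_iff_right_iff_imp]
    rintro rfl
    exact hC.selfDual.empty_mem
  have e36 := hC.selfDual.card_filter_compl (i := 36) (j := 8) rfl
  have e44 := hC.selfDual.card_filter_compl (i := 44) (j := 0) rfl
  rw [hC.card_eight] at e36
  rw [e0] at e44
  have key := sum_congr (rfl : C = C) fun c hc => kraw_certificate_weights _ (hC.card_cases hc)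
  simp only [sum_add_distrib, sum_sub_distrib, ← mul_sum, sum_boole, hC.selfDual.sum_kraw, e0,
    e36, e44, hC.card_eight, hC.card_eq, e 2 (by simp), e 4 (by simp), e 6 (by simp),
    e 10 (by simp)] at key
  simp only [halfSign] at h0
  rw [h0] at key
  norm_num at key

end Extremal

section Hexads

open Finset
open scoped symmDiff

/-- The hexads attached to a pair `a, b`: the words of weight 8 containing `a` and `b`, with these
two points removed. -/
def hexads (C : Finset (Finset (Fin 44))) (a b : Fin 44) : Finset (Finset (Fin 44)) :=
  {J | J.card = 6 ∧ J ⊆ {a, b}ᶜ ∧ J ∪ {a, b} ∈ C}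

/-- A code in the target class together with its weight-2 shadow vector. -/
structure IsPair (C : Finset (Finset (Fin 44))) (a b : Fin 44) : Prop extends IsTarget C where
  ne : a ≠ b
  shadow : ∀ c ∈ C, halfSign c = chi {a, b} c

/-- The words of `C` containing exactly one of `a` and `b`. -/
def oddPart (C : Finset (Finset (Fin 44))) (a b : Fin 44) : Finset (Finset (Fin 44)) :=
  {c ∈ C | chi {a, b} c = -1}

lemma chi_eq_one_or {α : Type*} [DecidableEq α] (J c : Finset α) :
    chi J c = 1 ∨ chi J c = -1 := neg_one_pow_eq_or ℤ _

lemma sum_chi_mul_kraw {α : Type*} [DecidableEq α] (S : Finset (Finset α)) {P R : Finset α}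
    (h : Disjoint P R) (j : ℕ) :
    ∑ c ∈ S, chi P c * kraw R.card j (R ∩ c).card =
      ∑ J ∈ R.powersetCard j, ∑ c ∈ S, chi (P ∪ J) c := by
  rw [sum_comm]
  refine sum_congr rfl fun c _ => ?_
  rw [← sum_chi_powersetCard, mul_sum]
  refine sum_congr rfl fun J hJ => ?_
  rw [chi_union (h.mono_right (mem_powersetCard.1 hJ).1)]

lemma card_filter_union_mem {α : Type*} [DecidableEq α] {F : Finset (Finset α)}
    {P R : Finset α} {j : ℕ} (hF : ∀ h ∈ F, h ⊆ R ∧ h.card = j + P.card) :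
    {J ∈ (R \ P).powersetCard j | P ∪ J ∈ F}.card = {h ∈ F | P ⊆ h}.card := by
  refine card_nbij' (P ∪ ·) (· \ P) ?_ ?_ ?_ ?_
  · intro J hJ
    simp only [coe_filter, Set.mem_ofPred_eq] at hJ ⊢
    exact ⟨hJ.2, subset_union_left⟩
  · intro h hh
    simp only [coe_filter, Set.mem_ofPred_eq, mem_powersetCard] at hh ⊢
    refine ⟨⟨sdiff_subset_sdiff (hF h hh.1).1 le_rfl, ?_⟩, ?_⟩
    · rw [card_sdiff_of_subset hh.2, (hF h hh.1).2, Nat.add_sub_cancel]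
    · rw [union_sdiff_of_subset hh.2]
      exact hh.1
  · intro J hJ
    simp only [coe_filter, Set.mem_ofPred_eq, mem_powersetCard] at hJ
    have : Disjoint J P := disjoint_of_subset_left hJ.1.1 sdiff_disjoint
    change (P ∪ J) \ P = J
    rw [union_sdiff_left, sdiff_eq_self_of_disjoint this]
  · intro h hh
    simp only [coe_filter, Set.mem_ofPred_eq] at hh
    exact union_sdiff_of_subset hh.2

variable {C : Finset (Finset (Fin 44))} {a b : Fin 44}

lemma mem_hexads {J : Finset (Fin 44)} :
    J ∈ hexads C a b ↔ J.card = 6 ∧ J ⊆ {a, b}ᶜ ∧ J ∪ {a, b} ∈ C := by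
  simp [hexads]

lemma disjoint_pair {J : Finset (Fin 44)} (hJ : J ⊆ {a, b}ᶜ) : Disjoint J {a, b} :=
  disjoint_of_subset_left hJ disjoint_compl_left

namespace IsPair

lemma card_compl_pair (hC : IsPair C a b) : ({a, b}ᶜ : Finset (Fin 44)).card = 42 := by
  have := card_compl_add {a, b}
  rw [card_pair hC.ne] at this
  omega

lemma card_union_pair (hC : IsPair C a b) {J : Finset (Fin 44)} (hJ : J ⊆ {a, b}ᶜ) :
    (J ∪ {a, b}).card = J.card + 2 := by
  rw [card_union_of_disjoint (disjoint_pair hJ), card_pair hC.ne]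

lemma sum_oddPart (hC : IsPair C a b) {J : Finset (Fin 44)} (hJ : J ⊆ {a, b}ᶜ) :
    ∑ c ∈ oddPart C a b, chi J c =
      2 ^ 21 * ((if J ∈ C then 1 else 0) - (if J ∪ {a, b} ∈ C then 1 else 0)) := by
  have h1 : 2 * ∑ c ∈ oddPart C a b, chi J c = ∑ c ∈ C, (chi J c - chi (J ∪ {a, b}) c) := by
    rw [oddPart, sum_filter, mul_sum]
    refine sum_congr rfl fun c _ => ?_
    rw [chi_union (disjoint_pair hJ)]
    rcases chi_eq_one_or {a, b} c with h | h <;> (simp [h]; try ring)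
  rw [sum_sub_distrib, hC.selfDual.sum_chi, hC.selfDual.sum_chi, hC.card_eq] at h1
  split_ifs at h1 ⊢ <;> push_cast at h1 <;> linarith

lemma sum_oddPart_empty (hC : IsPair C a b) : ∑ c ∈ oddPart C a b, chi ∅ c = 2 ^ 21 := by
  rw [hC.sum_oddPart (empty_subset _), if_pos hC.selfDual.empty_mem, if_neg]
  · simp
  · intro h
    have := hC.eq_empty_of_card_lt h (by rw [hC.card_union_pair (empty_subset _)]; simp)
    simp at this

lemma sum_oddPart_small (hC : IsPair C a b) {J : Finset (Fin 44)} (hJ : J ⊆ {a, b}ᶜ)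
    (h0 : 0 < J.card) (h6 : J.card < 6) : ∑ c ∈ oddPart C a b, chi J c = 0 := by
  rw [hC.sum_oddPart hJ, if_neg, if_neg]
  · simp
  · intro h
    have := hC.eq_empty_of_card_lt h (by rw [hC.card_union_pair hJ]; omega)
    simp at this
  · intro h
    have := hC.eq_empty_of_card_lt h (by omega)
    simp [this] at h0

lemma sum_oddPart_six (hC : IsPair C a b) {J : Finset (Fin 44)} (hJ : J ⊆ {a, b}ᶜ)
    (h6 : J.card = 6) :
    ∑ c ∈ oddPart C a b, chi J c = -2 ^ 21 * (if J ∈ hexads C a b then 1 else 0) := by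
  rw [hC.sum_oddPart hJ, if_neg]
  · have : J ∈ hexads C a b ↔ J ∪ {a, b} ∈ C := by
      rw [mem_hexads]
      exact ⟨fun h => h.2.2, fun h => ⟨h6, hJ, h⟩⟩
    simp only [this]
    ring
  · intro h
    have := hC.eq_empty_of_card_lt h (by omega)
    simp [this] at h6

lemma sum_oddPart_eight (hC : IsPair C a b) {J : Finset (Fin 44)} (hJ : J ⊆ {a, b}ᶜ)
    (h8 : J.card = 8) :
    ∑ c ∈ oddPart C a b, chi J c = 2 ^ 21 * (if J ∈ C then 1 else 0) := by
  rw [hC.sum_oddPart hJ, if_neg (c := J ∪ {a, b} ∈ C)]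
  · simp
  · intro h
    exact hC.ne_ten _ h (by rw [hC.card_union_pair hJ, h8])

lemma oddPart_card (hC : IsPair C a b) {c : Finset (Fin 44)} (hc : c ∈ oddPart C a b) :
    ({a, b}ᶜ ∩ c).card ∈ [13, 17, 21, 25, 29] := by
  obtain ⟨hc, hchi⟩ := mem_filter.1 hc
  have h1 := hC.shadow c hc
  have h2 := hC.card_cases hc
  have h3 : (({a, b} : Finset (Fin 44)) ∩ c).card = 1 := by
    have hle : (({a, b} : Finset (Fin 44)) ∩ c).card ≤ 2 :=
      (card_le_card inter_subset_left).trans_eq (card_pair hC.ne)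
    rw [chi] at hchi
    interval_cases ({a, b} ∩ c).card <;> simp_all
  have h4 := card_inter_add_card_sdiff c {a, b}
  rw [inter_comm, h3] at h4
  rw [inter_comm, ← sdiff_eq_inter_compl]
  rw [hchi, halfSign] at h1
  simp only [List.mem_cons, List.not_mem_nil, or_false] at h2 ⊢
  rcases h2 with h | h | h | h | h | h | h | h | h | h | h | h | h | h | h <;>
    first
    | (rw [h] at h1; norm_num at h1; done)
    | omega

/-- Every point lies in exactly 16 hexads. -/
lemma card_hexads_through (hC : IsPair C a b) {p : Fin 44} (hp : p ∈ ({a, b}ᶜ : Finset _)) :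
    {h ∈ hexads C a b | p ∈ h}.card = 16 := by
  have hR : ({a, b}ᶜ \ {p} : Finset (Fin 44)).card = 41 := by
    rw [card_sdiff_of_subset (singleton_subset_iff.2 hp), hC.card_compl_pair, card_singleton]
  have hd (j : ℕ) := sum_chi_mul_kraw (oddPart C a b) (P := {p}) (R := {a, b}ᶜ \ {p})
    disjoint_sdiff j
  have he (j : ℕ) := sum_chi_mul_kraw (oddPart C a b) (P := ∅) (R := {a, b}ᶜ \ {p})
    (disjoint_empty_left _) j
  have hsub {j : ℕ} {J : Finset (Fin 44)}
      (hJ : J ∈ ({a, b}ᶜ \ {p} : Finset (Fin 44)).powersetCard j) :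
      J ⊆ {a, b}ᶜ ∧ J.card = j ∧ {p} ∪ J ⊆ {a, b}ᶜ ∧ ({p} ∪ J).card = j + 1 := by
    obtain ⟨h1, h2⟩ := mem_powersetCard.1 hJ
    refine ⟨h1.trans sdiff_subset, h2,
      union_subset (singleton_subset_iff.2 hp) (h1.trans sdiff_subset), ?_⟩
    rw [card_union_of_disjoint (disjoint_sdiff.mono_right h1), h2, card_singleton, add_comm]
  rw [hR] at hd he
  have hd' (j : ℕ) (hj : j < 5) := (hd j).trans (sum_eq_zero fun J hJ =>
    hC.sum_oddPart_small (hsub hJ).2.2.1 (by rw [(hsub hJ).2.2.2]; omega)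
      (by rw [(hsub hJ).2.2.2]; omega))
  have he' (j : ℕ) (hj : 0 < j) (hj : j < 6) := (he j).trans (sum_eq_zero fun J hJ => by
    rw [empty_union]
    exact hC.sum_oddPart_small (hsub hJ).1 (by rw [(hsub hJ).2.1]; omega)
      (by rw [(hsub hJ).2.1]; omega))
  have he0 := he 0
  rw [powersetCard_zero, sum_singleton, empty_union, hC.sum_oddPart_empty] at he0
  have hd5 := (hd 5).trans (sum_congr rfl fun J hJ =>
    hC.sum_oddPart_six (hsub hJ).2.2.1 (hsub hJ).2.2.2)
  rw [← mul_sum, sum_boole, card_filter_union_mem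
    (fun h hh => ⟨(mem_hexads.1 hh).2.1, by rw [(mem_hexads.1 hh).1, card_singleton]⟩)] at hd5
  simp only [singleton_subset_iff] at hd5
  have cert : ∀ w ∈ [13, 17, 21, 25, 29],
      (16 * kraw 41 0 w + 4 * kraw 41 2 w + kraw 41 4 w +
        (16 * kraw 41 1 w + 4 * kraw 41 3 w + kraw 41 5 w) = 0) ∧
      (16 * kraw 41 0 (w - 1) + 4 * kraw 41 2 (w - 1) + kraw 41 4 (w - 1) -
        (16 * kraw 41 1 (w - 1) + 4 * kraw 41 3 (w - 1) + kraw 41 5 (w - 1)) = 0) := by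
    simp only [kraw, Nat.choose_eq_descFactorial_div_factorial]
    decide +kernel
  have key : ∑ c ∈ oddPart C a b,
      (16 * (chi ∅ c * kraw 41 0 ((({a, b}ᶜ \ {p} : Finset (Fin 44)) ∩ c).card)) +
        4 * (chi ∅ c * kraw 41 2 ((({a, b}ᶜ \ {p} : Finset (Fin 44)) ∩ c).card)) +
        chi ∅ c * kraw 41 4 ((({a, b}ᶜ \ {p} : Finset (Fin 44)) ∩ c).card) +
        16 * (chi {p} c * kraw 41 1 ((({a, b}ᶜ \ {p} : Finset (Fin 44)) ∩ c).card)) +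
        4 * (chi {p} c * kraw 41 3 ((({a, b}ᶜ \ {p} : Finset (Fin 44)) ∩ c).card)) +
        chi {p} c * kraw 41 5 ((({a, b}ᶜ \ {p} : Finset (Fin 44)) ∩ c).card)) = 0 := by
    refine sum_eq_zero fun c hc => ?_
    obtain ⟨h1, h2⟩ := cert _ (hC.oddPart_card hc)
    have he : chi ∅ c = 1 := by simp [chi]
    have hs : (({a, b}ᶜ \ {p} : Finset (Fin 44)) ∩ c).card =
        if p ∈ c then (({a, b}ᶜ : Finset (Fin 44)) ∩ c).card - 1
        else (({a, b}ᶜ : Finset (Fin 44)) ∩ c).card := by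
      rw [sdiff_inter_right_comm, sdiff_singleton_eq_erase, card_erase_eq_ite]
      simp only [mem_inter, hp, true_and]
    rw [he, hs, chi_singleton]
    split_ifs <;> linarith
  simp only [sum_add_distrib, ← mul_sum, he0, he' 2 (by simp) (by simp), he' 4 (by simp) (by simp),
    hd' 1 (by simp), hd' 3 (by simp), hd5] at key
  have : ({h ∈ hexads C a b | p ∈ h}.card : ℤ) = 16 := by linarith
  exact_mod_cast this

/-- The words of weight 8 avoiding `a` and `b`. -/
def octads (C : Finset (Finset (Fin 44))) (a b : Fin 44) : Finset (Finset (Fin 44)) :=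
  {J ∈ C | J.card = 8 ∧ J ⊆ {a, b}ᶜ}

lemma kraw_certificate_pair : ∀ w ∈ [13, 17, 21, 25, 29],
    (80 * kraw 40 0 w + 24 * kraw 40 2 w + 7 * kraw 40 4 w + kraw 40 6 w +
      (kraw 40 2 w - kraw 40 4 w) + 2 * (12 * kraw 40 1 w + 4 * kraw 40 3 w) = 0) ∧
    (-(80 * kraw 40 0 (w - 1) + 24 * kraw 40 2 (w - 1) + 7 * kraw 40 4 (w - 1) +
      kraw 40 6 (w - 1)) + (kraw 40 2 (w - 1) - kraw 40 4 (w - 1)) = 0) ∧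
    (80 * kraw 40 0 (w - 2) + 24 * kraw 40 2 (w - 2) + 7 * kraw 40 4 (w - 2) + kraw 40 6 (w - 2) +
      (kraw 40 2 (w - 2) - kraw 40 4 (w - 2)) -
      2 * (12 * kraw 40 1 (w - 2) + 4 * kraw 40 3 (w - 2)) = 0) := by
  simp only [kraw, Nat.choose_eq_descFactorial_div_factorial]
  decide +kernel

/-- Two points lie in seven times as many octads as hexads. -/
lemma card_octads_pair (hC : IsPair C a b) {p q : Fin 44} (hp : p ∈ ({a, b}ᶜ : Finset _))
    (hq : q ∈ ({a, b}ᶜ : Finset _)) (hpq : p ≠ q) :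
    {h ∈ octads C a b | {p, q} ⊆ h}.card = 7 * {h ∈ hexads C a b | {p, q} ⊆ h}.card := by
  have hPR : ({p, q} : Finset (Fin 44)) ⊆ {a, b}ᶜ :=
    insert_subset hp (singleton_subset_iff.2 hq)
  have hR : ({a, b}ᶜ \ {p, q} : Finset (Fin 44)).card = 40 := by
    rw [card_sdiff_of_subset hPR, hC.card_compl_pair, card_pair hpq]
  have hd {P : Finset (Fin 44)} (hP : P ⊆ {p, q}) (j : ℕ) :=
    sum_chi_mul_kraw (oddPart C a b) (disjoint_sdiff.mono_left hP : Disjoint P ({a, b}ᶜ \ {p, q})) j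
  have hsub {P : Finset (Fin 44)} (hP : P ⊆ {p, q}) {j : ℕ} {J : Finset (Fin 44)}
      (hJ : J ∈ ({a, b}ᶜ \ {p, q} : Finset (Fin 44)).powersetCard j) :
      P ∪ J ⊆ {a, b}ᶜ ∧ (P ∪ J).card = P.card + j := by
    obtain ⟨h1, h2⟩ := mem_powersetCard.1 hJ
    refine ⟨union_subset (hP.trans hPR) (h1.trans sdiff_subset), ?_⟩
    rw [card_union_of_disjoint (disjoint_sdiff.mono hP h1), h2]
  rw [hR] at hd
  have hd' {P : Finset (Fin 44)} (hP : P ⊆ {p, q}) (j : ℕ) (h0 : 0 < P.card + j)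
      (h6 : P.card + j < 6) := (hd hP j).trans (sum_eq_zero fun J hJ =>
    hC.sum_oddPart_small (hsub hP hJ).1 ((hsub hP hJ).2 ▸ h0) ((hsub hP hJ).2 ▸ h6))
  have hpp : ({p} : Finset (Fin 44)) ⊆ {p, q} := by simp
  have hqq : ({q} : Finset (Fin 44)) ⊆ {p, q} := by simp
  have hd4 := (hd le_rfl 4).trans (sum_congr rfl fun J hJ =>
    hC.sum_oddPart_six (hsub le_rfl hJ).1 (by rw [(hsub le_rfl hJ).2, card_pair hpq]))
  have hd6 := (hd le_rfl 6).trans (sum_congr rfl fun J hJ =>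
    hC.sum_oddPart_eight (hsub le_rfl hJ).1 (by rw [(hsub le_rfl hJ).2, card_pair hpq]))
  rw [← mul_sum, sum_boole, card_filter_union_mem (fun h hh => ⟨(mem_hexads.1 hh).2.1, by
    rw [(mem_hexads.1 hh).1, card_pair hpq]⟩)] at hd4
  have ho : {J ∈ ({a, b}ᶜ \ {p, q} : Finset (Fin 44)).powersetCard 6 | {p, q} ∪ J ∈ C} =
      {J ∈ ({a, b}ᶜ \ {p, q} : Finset (Fin 44)).powersetCard 6 |
        {p, q} ∪ J ∈ octads C a b} := by
    refine filter_congr fun J hJ => ?_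
    rw [octads, mem_filter, (hsub le_rfl hJ).2, card_pair hpq]
    simp only [(hsub le_rfl hJ).1, and_true]
  rw [← mul_sum, sum_boole, ho, card_filter_union_mem (fun h hh =>
    ⟨(mem_filter.1 hh).2.2, by rw [(mem_filter.1 hh).2.1, card_pair hpq]⟩)] at hd6
  have key : ∑ c ∈ oddPart C a b,
      (80 * (chi {p, q} c * kraw 40 0 ((({a, b}ᶜ \ {p, q} : Finset (Fin 44)) ∩ c).card)) +
        24 * (chi {p, q} c * kraw 40 2 ((({a, b}ᶜ \ {p, q} : Finset (Fin 44)) ∩ c).card)) +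
        7 * (chi {p, q} c * kraw 40 4 ((({a, b}ᶜ \ {p, q} : Finset (Fin 44)) ∩ c).card)) +
        chi {p, q} c * kraw 40 6 ((({a, b}ᶜ \ {p, q} : Finset (Fin 44)) ∩ c).card) +
        chi ∅ c * kraw 40 2 ((({a, b}ᶜ \ {p, q} : Finset (Fin 44)) ∩ c).card) -
        chi ∅ c * kraw 40 4 ((({a, b}ᶜ \ {p, q} : Finset (Fin 44)) ∩ c).card) +
        12 * (chi {p} c * kraw 40 1 ((({a, b}ᶜ \ {p, q} : Finset (Fin 44)) ∩ c).card)) +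
        4 * (chi {p} c * kraw 40 3 ((({a, b}ᶜ \ {p, q} : Finset (Fin 44)) ∩ c).card)) +
        12 * (chi {q} c * kraw 40 1 ((({a, b}ᶜ \ {p, q} : Finset (Fin 44)) ∩ c).card)) +
        4 * (chi {q} c * kraw 40 3 ((({a, b}ᶜ \ {p, q} : Finset (Fin 44)) ∩ c).card))) = 0 := by
    refine sum_eq_zero fun c hc => ?_
    obtain ⟨h1, h2, h3⟩ := kraw_certificate_pair _ (hC.oddPart_card hc)
    have he : chi ∅ c = 1 := by simp [chi]
    have hs : (({a, b}ᶜ \ {p, q} : Finset (Fin 44)) ∩ c).card =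
        (({a, b}ᶜ : Finset (Fin 44)) ∩ c).card - ((if p ∈ c then 1 else 0) +
          (if q ∈ c then 1 else 0)) := by
      have : ({a, b}ᶜ \ {p, q} : Finset (Fin 44)) = (({a, b}ᶜ : Finset _).erase p).erase q := by
        ext x
        simp only [mem_sdiff, mem_insert, mem_singleton, mem_erase]
        tauto
      rw [this, erase_inter, erase_inter, card_erase_eq_ite, card_erase_eq_ite]
      simp only [mem_erase, mem_inter, hp, hq, hpq.symm, true_and, ne_eq, not_false_eq_true]
      split_ifs <;> omega
    have hx : chi {p, q} c = chi {p} c * chi {q} c := by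
      rw [← chi_union (disjoint_singleton.2 hpq)]
      rfl
    rw [he, hs, hx, chi_singleton, chi_singleton]
    split_ifs <;> simp only [Nat.reduceAdd, Nat.sub_zero] <;> linarith
  rw [sum_add_distrib, sum_add_distrib, sum_add_distrib, sum_add_distrib, sum_sub_distrib,
    sum_add_distrib, sum_add_distrib, sum_add_distrib, sum_add_distrib] at key
  simp only [← mul_sum] at key
  rw [hd' le_rfl 0 (by simp [card_pair hpq]) (by simp [card_pair hpq]),
    hd' le_rfl 2 (by simp [card_pair hpq]) (by simp [card_pair hpq]), hd4, hd6,
    hd' (empty_subset _) 2 (by simp) (by simp), hd' (empty_subset _) 4 (by simp) (by simp),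
    hd' hpp 1 (by simp) (by simp), hd' hpp 3 (by simp) (by simp),
    hd' hqq 1 (by simp) (by simp), hd' hqq 3 (by simp) (by simp)] at key
  zify
  linarith

end IsPair
end Hexads

section HexadSystem

open Finset
open scoped symmDiff

variable {α : Type*} [DecidableEq α]

/-- The combinatorial properties of the hexads of a code in the target class. -/
structure HexadSystem (R : Finset α) (H : Finset (Finset α)) : Prop where
  card_ground : R.card = 42
  subset : ∀ h ∈ H, h ⊆ R
  card_hexad : ∀ h ∈ H, h.card = 6
  card_inter : ∀ h ∈ H, ∀ k ∈ H, h ≠ k → (h ∩ k).Nonempty → (h ∩ k).card = 2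
  card_through : ∀ p ∈ R, {h ∈ H | p ∈ h}.card = 16
  trans : ∀ h ∈ H, ∀ k ∈ H, ∀ p q y, q ∈ h → y ∈ h → p ∈ k → q ∈ k → p ∉ h → y ∉ k →
    ∃ l ∈ H, p ∈ l ∧ y ∈ l

lemma IsPair.symmDiff_hexads {C : Finset (Finset (Fin 44))} {a b : Fin 44} (hC : IsPair C a b)
    {h k : Finset (Fin 44)} (hh : h ∈ hexads C a b) (hk : k ∈ hexads C a b) (hne : h ≠ k)
    (hi : (h ∩ k).Nonempty) : h ∆ k ∈ octads C a b ∧ (h ∩ k).card = 2 := by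
  obtain ⟨hh6, hhR, hhC⟩ := mem_hexads.1 hh
  obtain ⟨hk6, hkR, hkC⟩ := mem_hexads.1 hk
  have hC' : h ∆ k ∈ C := by
    have := hC.selfDual.symmDiff_mem hhC hkC
    have e : (h ∪ {a, b}) ∆ (k ∪ {a, b}) = h ∆ k := by
      have h1 := disjoint_pair hhR
      have h2 := disjoint_pair hkR
      rw [disjoint_left] at h1 h2
      ext x
      have h1 := @h1 x
      have h2 := @h2 x
      simp only [mem_symmDiff, mem_union] at h1 h2 ⊢
      tauto
    rwa [e] at this
  have hR : h ∆ k ⊆ {a, b}ᶜ := fun x hx => by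
    rcases mem_symmDiff.1 hx with hx | hx
    · exact hhR hx.1
    · exact hkR hx.1
  have hcard := card_symmDiff_add h k
  have h8 := hC.eight_le _ hC' (fun e => hne (symmDiff_eq_bot.1 e))
  have h10 := hC.ne_ten _ hC'
  have hpos := card_pos.2 hi
  rw [hh6, hk6] at hcard
  refine ⟨mem_filter.2 ⟨hC', ?_, hR⟩, ?_⟩ <;> omega

lemma IsPair.hexadSystem {C : Finset (Finset (Fin 44))} {a b : Fin 44} (hC : IsPair C a b) :
    HexadSystem {a, b}ᶜ (hexads C a b) where
  card_ground := hC.card_compl_pair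
  subset h hh := (mem_hexads.1 hh).2.1
  card_hexad h hh := (mem_hexads.1 hh).1
  card_through p hp := hC.card_hexads_through hp
  card_inter h hh k hk hne hi := (hC.symmDiff_hexads hh hk hne hi).2
  trans h hh k hk p q y hqh hyh hpk hqk hph hyk := by
    have hne : h ≠ k := fun e => hph (e ▸ hpk)
    obtain ⟨h1, h2⟩ := hC.symmDiff_hexads hh hk hne ⟨q, mem_inter.2 ⟨hqh, hqk⟩⟩
    have hpm : p ∈ ({a, b}ᶜ : Finset (Fin 44)) := (mem_hexads.1 hk).2.1 hpk
    have hym : y ∈ ({a, b}ᶜ : Finset (Fin 44)) := (mem_hexads.1 hh).2.1 hyh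
    have hpos : 0 < {o ∈ octads C a b | {p, y} ⊆ o}.card := by
      refine card_pos.2 ⟨h ∆ k, mem_filter.2 ⟨h1, insert_subset ?_ (singleton_subset_iff.2 ?_)⟩⟩
      · exact mem_symmDiff.2 (Or.inr ⟨hpk, hph⟩)
      · exact mem_symmDiff.2 (Or.inl ⟨hyh, hyk⟩)
    rw [hC.card_octads_pair hpm hym (fun e => hph (e ▸ hyh))] at hpos
    obtain ⟨l, hl⟩ := card_pos.1 (Nat.pos_of_mul_pos_left hpos)
    obtain ⟨hl, hpy⟩ := mem_filter.1 hl
    exact ⟨l, hl, hpy (by simp), hpy (by simp)⟩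

end HexadSystem

section HexadSystem

open Finset

variable {α : Type*} [DecidableEq α]

/-- The number of hexads through `p` and `q`. -/
def through (H : Finset (Finset α)) (p q : α) : ℕ := {h ∈ H | p ∈ h ∧ q ∈ h}.card

/-- The points joined to `p` by a hexad. -/
def block (R : Finset α) (H : Finset (Finset α)) (p : α) : Finset α :=
  {q ∈ R | ∃ h ∈ H, p ∈ h ∧ q ∈ h}

namespace HexadSystem

variable {R : Finset α} {H : Finset (Finset α)}

lemma mem_block {p q : α} (hH : HexadSystem R H) :
    q ∈ block R H p ↔ ∃ h ∈ H, p ∈ h ∧ q ∈ h := by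
  simp only [block, mem_filter, and_iff_right_iff_imp]
  rintro ⟨h, hh, -, hq⟩
  exact hH.subset h hh hq

lemma mem_block_iff_through_pos {p q : α} (hH : HexadSystem R H) :
    q ∈ block R H p ↔ 0 < through H p q := by
  rw [hH.mem_block, through, card_pos]
  simp [Finset.Nonempty]

lemma self_mem_block (hH : HexadSystem R H) {p : α} (hp : p ∈ R) : p ∈ block R H p := by
  have h : 0 < {h ∈ H | p ∈ h}.card := by rw [hH.card_through p hp]; norm_num
  obtain ⟨h, hh⟩ := card_pos.1 h
  obtain ⟨hh, hp⟩ := mem_filter.1 hh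
  exact hH.mem_block.2 ⟨h, hh, hp, hp⟩

lemma mem_block_comm (hH : HexadSystem R H) {p q : α} :
    q ∈ block R H p ↔ p ∈ block R H q := by
  simp only [hH.mem_block, and_comm]

lemma mem_block_trans (hH : HexadSystem R H) {p q y : α} (h1 : q ∈ block R H p)
    (h2 : y ∈ block R H q) : y ∈ block R H p := by
  obtain ⟨k, hk, hpk, hqk⟩ := hH.mem_block.1 h1
  obtain ⟨h, hh, hqh, hyh⟩ := hH.mem_block.1 h2
  by_cases hp : p ∈ h
  · exact hH.mem_block.2 ⟨h, hh, hp, hyh⟩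
  by_cases hy : y ∈ k
  · exact hH.mem_block.2 ⟨k, hk, hpk, hy⟩
  exact hH.mem_block.2 (hH.trans h hh k hk p q y hqh hyh hpk hqk hp hy)

lemma block_eq (hH : HexadSystem R H) {p q : α} (h : q ∈ block R H p) :
    block R H q = block R H p := by
  ext y
  exact ⟨hH.mem_block_trans h, hH.mem_block_trans (hH.mem_block_comm.1 h)⟩

lemma sum_through (hH : HexadSystem R H) {p : α} (hp : p ∈ R) :
    ∑ q ∈ (block R H p).erase p, through H p q = 80 := by
  have h1 : ∑ q ∈ (block R H p).erase p, through H p q =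
      ∑ h ∈ H with p ∈ h, (h.erase p).card := by
    simp_rw [through, ← filter_filter, card_filter _ (filter _ H)]
    rw [sum_comm]
    refine sum_congr rfl fun h hh => ?_
    obtain ⟨hh, hph⟩ := mem_filter.1 hh
    rw [← card_filter]
    congr 1
    ext q
    simp only [mem_filter, mem_erase]
    exact ⟨fun h => ⟨h.1.1, h.2⟩, fun hq => ⟨⟨hq.1, hH.mem_block.2 ⟨h, hh, hph, hq.2⟩⟩, hq.2⟩⟩
  rw [h1, sum_congr rfl (g := fun _ => 5), sum_const, hH.card_through p hp, smul_eq_mul]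
  intro h hh
  obtain ⟨hh, hph⟩ := mem_filter.1 hh
  rw [card_erase_of_mem hph, hH.card_hexad h hh]

lemma sum_through_sq (hH : HexadSystem R H) {p : α} (hp : p ∈ R) :
    ∑ q ∈ (block R H p).erase p, through H p q ^ 2 = 320 := by
  have h1 : ∑ q ∈ (block R H p).erase p, through H p q ^ 2 =
      ∑ h ∈ H with p ∈ h, ∑ k ∈ H with p ∈ k, ((h ∩ k).erase p).card := by
    have e (q : α) : through H p q ^ 2 =
        ∑ h ∈ H with p ∈ h, ∑ k ∈ H with p ∈ k, if q ∈ h ∩ k then 1 else 0 := by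
      rw [sq, through, ← filter_filter, card_filter, sum_mul_sum]
      refine sum_congr rfl fun h _ => sum_congr rfl fun k _ => ?_
      by_cases h1 : q ∈ h <;> by_cases h2 : q ∈ k <;> simp [h1, h2]
    simp_rw [e]
    rw [sum_comm]
    refine sum_congr rfl fun h hh => ?_
    obtain ⟨hh, hph⟩ := mem_filter.1 hh
    rw [sum_comm]
    refine sum_congr rfl fun k hk => ?_
    rw [← card_filter]
    congr 1
    ext q
    simp only [mem_filter, mem_erase, mem_inter]
    exact ⟨fun h => ⟨h.1.1, h.2⟩,
      fun hq => ⟨⟨hq.1, hH.mem_block.2 ⟨h, hh, hph, hq.2.1⟩⟩, hq.2⟩⟩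
  have h2 : ∀ h ∈ ({h ∈ H | p ∈ h} : Finset _),
      ∑ k ∈ H with p ∈ k, ((h ∩ k).erase p).card = 20 := by
    intro h hh
    rw [← add_sum_erase _ _ hh]
    obtain ⟨hhH, hph⟩ := mem_filter.1 hh
    rw [sum_congr rfl (g := fun _ => 1), sum_const, card_erase_of_mem hh, hH.card_through p hp,
      inter_self, card_erase_of_mem hph, hH.card_hexad h hhH, smul_eq_mul]
    intro k hk
    obtain ⟨hne, hk⟩ := mem_erase.1 hk
    obtain ⟨hkH, hpk⟩ := mem_filter.1 hk
    have hpi := mem_inter.2 ⟨hph, hpk⟩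
    rw [card_erase_of_mem hpi, hH.card_inter h hhH k hkH hne.symm ⟨p, hpi⟩]
  rw [h1, sum_congr rfl h2, sum_const, hH.card_through p hp, smul_eq_mul]

lemma sum_through_sub (hH : HexadSystem R H) {p : α} (hp : p ∈ R) :
    ∑ q ∈ (block R H p).erase p, ((through H p q : ℤ) - 4) ^ 2 =
      16 * (((block R H p).card : ℤ) - 21) := by
  have h1 := hH.sum_through hp
  have h2 := hH.sum_through_sq hp
  zify at h1 h2
  have h3 : ∑ q ∈ (block R H p).erase p, ((through H p q : ℤ) - 4) ^ 2 =
      ∑ q ∈ (block R H p).erase p, (through H p q : ℤ) ^ 2 -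
        8 * ∑ q ∈ (block R H p).erase p, (through H p q : ℤ) +
        16 * ((block R H p).erase p).card := by
    rw [mul_sum, ← sum_sub_distrib, mul_comm (16 : ℤ), ← nsmul_eq_mul, ← sum_const,
      ← sum_add_distrib]
    exact sum_congr rfl fun q _ => by ring
  have h4 := card_erase_add_one (hH.self_mem_block hp)
  zify at h4
  rw [h3, h1, h2, ← h4]
  ring

lemma le_card_block (hH : HexadSystem R H) {p : α} (hp : p ∈ R) : 21 ≤ (block R H p).card := by
  have h := sum_nonneg fun q (_ : q ∈ (block R H p).erase p) => sq_nonneg ((through H p q : ℤ) - 4)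
  rw [hH.sum_through_sub hp] at h
  omega

lemma through_eq_four (hH : HexadSystem R H) {p q : α} (hp : p ∈ R)
    (h21 : (block R H p).card = 21) (hq : q ∈ block R H p) (hne : q ≠ p) :
    through H p q = 4 := by
  have h := hH.sum_through_sub hp
  rw [h21, Nat.cast_ofNat, sub_self, mul_zero,
    sum_eq_zero_iff_of_nonneg fun _ _ => sq_nonneg _] at h
  have := pow_eq_zero_iff (two_ne_zero) |>.1 (h q (mem_erase.2 ⟨hne, hq⟩))
  omega

/-- If two points lie in at least five hexads, then their hexads cover the block. -/
lemma card_block_le (hH : HexadSystem R H) {p q : α} (hp : p ∈ R) (hne : q ≠ p)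
    (h5 : 5 ≤ through H p q) : (block R H p).card ≤ 22 := by
  set S := {h ∈ H | p ∈ h ∧ q ∈ h} with hS
  have hScard : S.card = through H p q := rfl
  have hmem {h : Finset α} (hh : h ∈ S) : h ∈ H ∧ p ∈ h ∧ q ∈ h := mem_filter.1 hh
  have hpair {h : Finset α} (hh : h ∈ S) : {p, q} ⊆ h :=
    insert_subset (hmem hh).2.1 (singleton_subset_iff.2 (hmem hh).2.2)
  have hdisj : (S : Set (Finset α)).PairwiseDisjoint (· \ {p, q}) := by
    intro h hh k hk hhk
    rw [mem_coe] at hh hk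
    have h2 := hH.card_inter h (hmem hh).1 k (hmem hk).1 hhk
      ⟨p, mem_inter.2 ⟨(hmem hh).2.1, (hmem hk).2.1⟩⟩
    have e : ({p, q} : Finset α) = h ∩ k := eq_of_subset_of_card_le
      (subset_inter (hpair hh) (hpair hk)) (by rw [h2, card_pair hne.symm])
    change Disjoint (h \ {p, q}) (k \ {p, q})
    rw [disjoint_left]
    intro x hx hx'
    rw [e, mem_sdiff, mem_inter] at hx hx'
    exact hx.2 ⟨hx.1, hx'.1⟩
  have hcov {k : Finset α} (hk : k ∈ H) (hpk : p ∈ k) (hqk : q ∉ k) :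
      S.card ≤ 5 ∧ (S.card = 5 → k.erase p ⊆ S.biUnion (· \ {p, q})) := by
    have h1 {h : Finset α} (hh : h ∈ S) : (k ∩ (h \ {p, q})).card = 1 := by
      have h2 := hH.card_inter k hk h (hmem hh).1 (fun e => hqk (e ▸ (hmem hh).2.2))
        ⟨p, mem_inter.2 ⟨hpk, (hmem hh).2.1⟩⟩
      have e : k ∩ (h \ {p, q}) = (k ∩ h).erase p := by
        ext x
        simp only [mem_inter, mem_sdiff, mem_insert, mem_singleton, mem_erase]
        constructor
        · tauto
        · rintro ⟨h1, h2, h3⟩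
          exact ⟨h2, h3, fun h => h.elim h1 fun h => hqk (h ▸ h2)⟩
      rw [e, card_erase_of_mem (mem_inter.2 ⟨hpk, (hmem hh).2.1⟩), h2]
    have h2 : (k ∩ S.biUnion (· \ {p, q})).card = S.card := by
      rw [inter_biUnion, card_biUnion, sum_congr rfl fun h hh => h1 hh, sum_const, smul_eq_mul,
        mul_one]
      intro h hh h' hh' hne
      exact (hdisj hh hh' hne).mono inter_subset_right inter_subset_right
    have h3 : k ∩ S.biUnion (· \ {p, q}) ⊆ k.erase p := by
      intro x hx
      obtain ⟨hx, hx'⟩ := mem_inter.1 hx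
      obtain ⟨h, hh, hx'⟩ := mem_biUnion.1 hx'
      simp only [mem_sdiff, mem_insert, mem_singleton, not_or] at hx'
      exact mem_erase.2 ⟨hx'.2.1, hx⟩
    have h4 : (k.erase p).card = 5 := by rw [card_erase_of_mem hpk, hH.card_hexad k hk]
    refine ⟨by rw [← h2, ← h4]; exact card_le_card h3, fun h => ?_⟩
    rw [← eq_of_subset_of_card_le h3 (by rw [h4, h2, h])]
    exact inter_subset_right
  have hQ : (S.biUnion (· \ {p, q})).card = 4 * S.card := by
    rw [card_biUnion fun h hh k hk hne => hdisj hh hk hne, sum_congr rfl (g := fun _ => 4),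
      sum_const,
      smul_eq_mul, mul_comm]
    intro h hh
    rw [card_sdiff_of_subset (hpair hh), hH.card_hexad h (hmem hh).1, card_pair hne.symm]
  have hle : S.card ≤ 5 := by
    by_contra hlt
    have hall : ∀ k ∈ H, p ∈ k → q ∈ k := fun k hk hpk => by
      by_contra hqk
      exact hlt (hcov hk hpk hqk).1
    have h16 : S.card = 16 := by
      rw [← hH.card_through p hp]
      congr 1
      exact filter_congr fun k hk => ⟨fun h => h.1, fun h => ⟨h, hall k hk h⟩⟩
    have hsub : S.biUnion (· \ {p, q}) ⊆ R := biUnion_subset.2 fun h hh =>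
      sdiff_subset.trans (hH.subset h (hmem hh).1)
    have := card_le_card hsub
    rw [hQ, h16, hH.card_ground] at this
    omega
  have hfive : S.card = 5 := le_antisymm hle h5
  have hblock : block R H p ⊆ {p, q} ∪ S.biUnion (· \ {p, q}) := by
    intro x hx
    obtain ⟨k, hk, hpk, hxk⟩ := hH.mem_block.1 hx
    simp only [mem_union, mem_insert, mem_singleton]
    by_cases hxp : x = p
    · exact Or.inl (Or.inl hxp)
    by_cases hxq : x = q
    · exact Or.inl (Or.inr hxq)
    right
    by_cases hqk : q ∈ k
    · exact mem_biUnion.2 ⟨k, mem_filter.2 ⟨hk, hpk, hqk⟩, by simp [hxk, hxp, hxq]⟩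
    · exact (hcov hk hpk hqk).2 hfive (mem_erase.2 ⟨hxp, hxk⟩)
  refine (card_le_card hblock).trans ((card_union_le _ _).trans ?_)
  rw [hQ, hfive, card_pair hne.symm]

lemma block_ne_ground (hH : HexadSystem R H) {p : α} (hp : p ∈ R) : block R H p ≠ R := by
  intro hR
  have h1 := hH.sum_through hp
  have h2 := hH.sum_through_sub hp
  rw [hR, hH.card_ground] at h2
  rw [hR] at h1
  have hcard : (R.erase p).card = 41 := by rw [card_erase_of_mem hp, hH.card_ground]
  have hle : ∀ q ∈ R.erase p, through H p q ≤ 4 := by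
    intro q hq
    by_contra hlt
    have := hH.card_block_le hp (mem_erase.1 hq).1 (by omega)
    rw [hR, hH.card_ground] at this
    omega
  have hpos : ∀ q ∈ R.erase p, 1 ≤ through H p q := fun q hq =>
    hH.mem_block_iff_through_pos.1 (by rw [hR]; exact mem_of_mem_erase hq)
  have h3 : ∑ q ∈ R.erase p, ((through H p q : ℤ) - 4) ^ 2 ≤
      ∑ q ∈ R.erase p, (16 - 4 * (through H p q : ℤ)) := by
    refine sum_le_sum fun q hq => ?_
    have := hle q hq
    have := hpos q hq
    zify at *
    nlinarith
  have h4 : ∑ q ∈ R.erase p, (16 - 4 * (through H p q : ℤ)) = 336 := by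
    zify at h1
    rw [sum_sub_distrib, ← mul_sum, h1, sum_const, hcard]
    norm_num
  have h5 : ∀ q ∈ R.erase p, ((through H p q : ℤ) - 4) ^ 2 = 16 - 4 * (through H p q : ℤ) := by
    refine (sum_eq_sum_iff_of_le fun q hq => ?_).1 (by rw [h4, h2]; norm_num)
    have := hle q hq
    have := hpos q hq
    zify at *
    nlinarith
  have h6 : ∀ q ∈ R.erase p, through H p q = 4 := by
    intro q hq
    have h5 := h5 q hq
    have := hle q hq
    have := hpos q hq
    interval_cases through H p q <;> simp_all
  rw [sum_congr rfl h6, sum_const, hcard] at h1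
  norm_num at h1

lemma exists_disjoint_block (hH : HexadSystem R H) {p : α} (hp : p ∈ R) :
    ∃ r ∈ R, (block R H p).card = 21 ∧ (block R H r).card = 21 ∧
      Disjoint (block R H p) (block R H r) := by
  have hsub (x : α) : block R H x ⊆ R := filter_subset _ _
  obtain ⟨r, hr, hrp⟩ := not_subset.1 fun h => hH.block_ne_ground hp ((hsub p).antisymm h)
  have hd : Disjoint (block R H p) (block R H r) := disjoint_left.2 fun y hy hy' =>
    hrp (hH.mem_block_trans hy (hH.mem_block_comm.1 hy'))
  have h1 := card_le_card (union_subset (hsub p) (hsub r))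
  rw [card_union_of_disjoint hd, hH.card_ground] at h1
  have h2 := hH.le_card_block hp
  have h3 := hH.le_card_block hr
  exact ⟨r, hr, by omega, by omega, hd⟩

end HexadSystem
end HexadSystem

section Frame

open Finset

variable {α : Type*} [DecidableEq α]

/-- A system of 6-subsets of a 21-set, any two of which are disjoint or meet in two points, such
that any two points lie in four of them. -/
structure HexadBlock (U : Finset α) (H : Finset (Finset α)) : Prop where
  card_ground : U.card = 21
  subset : ∀ h ∈ H, h ⊆ U
  card_hexad : ∀ h ∈ H, h.card = 6
  card_inter : ∀ h ∈ H, ∀ k ∈ H, h ≠ k → (h ∩ k).Nonempty → (h ∩ k).card = 2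
  card_through : ∀ p ∈ U, ∀ q ∈ U, p ≠ q → {h ∈ H | p ∈ h ∧ q ∈ h}.card = 4

lemma HexadSystem.hexadBlock {R : Finset α} {H : Finset (Finset α)} (hH : HexadSystem R H) {p : α}
    (hp : p ∈ R) : HexadBlock (block R H p) {h ∈ H | h ⊆ block R H p} where
  card_ground := (hH.exists_disjoint_block hp).choose_spec.2.1
  subset h hh := (mem_filter.1 hh).2
  card_hexad h hh := hH.card_hexad h (mem_filter.1 hh).1
  card_inter h hh k hk := hH.card_inter h (mem_filter.1 hh).1 k (mem_filter.1 hk).1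
  card_through x hx y hy hxy := by
    have hxR : x ∈ R := (mem_filter.1 hx).1
    have h1 : block R H x = block R H p := hH.block_eq hx
    rw [← hH.through_eq_four hxR (hH.exists_disjoint_block hxR).choose_spec.2.1 (h1 ▸ hy) hxy.symm,
      through, filter_filter]
    congr 1
    refine filter_congr fun h hh => ⟨fun h => h.2, fun hxy => ⟨fun z hz => ?_, hxy⟩⟩
    rw [← h1]
    exact hH.mem_block.2 ⟨h, hh, hxy.1, hz⟩

/-- A coordinate frame of a hexad block: the hexads through `p` and `q` are the rows, and those
through `p` and `t 0` are the columns. -/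
structure Frame (H : Finset (Finset α)) (p q : α) (t : Fin 3 → α) (x : Fin 4 → Fin 4 → α) :
    Prop where
  ne : p ≠ q
  t_inj : Function.Injective t
  t_ne_left : ∀ j, t j ≠ p
  t_ne_right : ∀ j, t j ≠ q
  x_inj : ∀ {i j k l}, x i k = x j l → i = j ∧ k = l
  x_ne_left : ∀ i k, x i k ≠ p
  x_ne_right : ∀ i k, x i k ≠ q
  x_ne_t : ∀ i k j, x i k ≠ t j
  row : ∀ i, {p, q} ∪ univ.image (x i) ∈ H
  col : ∀ k, {p, t 0} ∪ univ.image (x · k) ∈ H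
  off : ∀ h ∈ H, p ∈ h → q ∈ h → ∀ j, t j ∉ h

lemma image_comp_equiv {β γ : Type*} [Fintype β] (σ : Equiv.Perm β) [DecidableEq γ]
    (f : β → γ) : univ.image (fun i => f (σ i)) = univ.image f := by
  ext y
  simp only [mem_image, mem_univ, true_and]
  exact (σ.surjective.exists (p := fun i => f i = y)).symm

lemma Frame.reindex {H : Finset (Finset α)} {p q : α} {t : Fin 3 → α} {x : Fin 4 → Fin 4 → α}
    (F : Frame H p q t x) (π σ : Equiv.Perm (Fin 4)) :
    Frame H p q t fun i k => x (π i) (σ k) where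
  ne := F.ne
  t_inj := F.t_inj
  t_ne_left := F.t_ne_left
  t_ne_right := F.t_ne_right
  x_inj h := ⟨π.injective (F.x_inj h).1, σ.injective (F.x_inj h).2⟩
  x_ne_left _ _ := F.x_ne_left _ _
  x_ne_right _ _ := F.x_ne_right _ _
  x_ne_t _ _ _ := F.x_ne_t _ _ _
  row i := by rw [image_comp_equiv σ (x (π i))]; exact F.row _
  col k := by rw [image_comp_equiv π (x · (σ k))]; exact F.col _
  off := F.off

namespace HexadBlock

variable {U : Finset α} {H : Finset (Finset α)}

lemma eq_of_three (hH : HexadBlock U H) {h k : Finset α} (hh : h ∈ H) (hk : k ∈ H) {x y z : α}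
    (hx : x ∈ h) (hy : y ∈ h) (hz : z ∈ h) (hx' : x ∈ k) (hy' : y ∈ k) (hz' : z ∈ k)
    (hxy : x ≠ y) (hxz : x ≠ z) (hyz : y ≠ z) : h = k := by
  by_contra hne
  have h2 := hH.card_inter h hh k hk hne ⟨x, mem_inter.2 ⟨hx, hx'⟩⟩
  have h3 : ({x, y, z} : Finset α) ⊆ h ∩ k := by
    intro w hw
    simp only [mem_insert, mem_singleton] at hw
    rcases hw with rfl | rfl | rfl <;> simp [*]
  have := card_le_card h3
  rw [h2, card_eq_three.2 ⟨x, y, z, hxy, hxz, hyz, rfl⟩] at this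
  omega

lemma exists_second (hH : HexadBlock U H) {h k : Finset α} (hh : h ∈ H) (hk : k ∈ H) (hne : h ≠ k)
    {u : α} (hu : u ∈ h) (hu' : u ∈ k) : ∃ x ∈ h, x ∈ k ∧ x ≠ u := by
  have h2 := hH.card_inter h hh k hk hne ⟨u, mem_inter.2 ⟨hu, hu'⟩⟩
  obtain ⟨x, hx, hne⟩ := exists_mem_ne (by omega : 1 < (h ∩ k).card) u
  exact ⟨x, (mem_inter.1 hx).1, (mem_inter.1 hx).2, hne⟩

lemma exists_hexad_three (hH : HexadBlock U H) {h : Finset α} (hh : h ∈ H) {u v t x : α}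
    (huv : u ≠ v) (hu : u ∈ h) (hv : v ∈ h) (ht : t ∈ U)
    (hoff : ∀ k ∈ H, u ∈ k → v ∈ k → t ∉ k) (hx : x ∈ h) (hxu : x ≠ u) (hxv : x ≠ v) :
    ∃ k ∈ H, u ∈ k ∧ t ∈ k ∧ x ∈ k := by
  have hth := hoff h hh hu hv
  have hut : u ≠ t := fun e => hth (e ▸ hu)
  set F := {k ∈ H | u ∈ k ∧ t ∈ k} with hF
  have hFc : F.card = 4 := hH.card_through u (hH.subset h hh hu) t ht hut
  have hmem {k : Finset α} (hk : k ∈ F) : k ∈ H ∧ u ∈ k ∧ t ∈ k := mem_filter.1 hk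
  have : Nonempty α := ⟨u⟩
  choose! y hyh hyk hyu using fun k (hk : k ∈ F) =>
    hH.exists_second hh (hmem hk).1 (fun e => hth (e ▸ (hmem hk).2.2)) hu (hmem hk).2.1
  have hmaps : Set.MapsTo y (F : Set (Finset α)) ((h \ {u, v} : Finset α) : Set α) := by
    intro k hk
    rw [mem_coe] at hk ⊢
    have := hyh k hk
    simp only [mem_sdiff, mem_insert, mem_singleton, not_or]
    refine ⟨this, hyu k hk, fun e => ?_⟩
    exact hoff k (hmem hk).1 (hmem hk).2.1 (e ▸ hyk k hk) (hmem hk).2.2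
  have hinj : Set.InjOn y (F : Set (Finset α)) := by
    intro k hk l hl hkl
    rw [mem_coe] at hk hl
    exact hH.eq_of_three (hmem hk).1 (hmem hl).1 (hmem hk).2.1 (hmem hk).2.2 (hyk k hk)
      (hmem hl).2.1 (hmem hl).2.2 (hkl ▸ hyk l hl) hut (hyu k hk).symm
      fun e => hth (e ▸ hyh k hk)
  have hcard : (h \ {u, v} : Finset α).card ≤ F.card := by
    rw [card_sdiff_of_subset (insert_subset hu (singleton_subset_iff.2 hv)), card_pair huv,
      hH.card_hexad h hh, hFc]
  obtain ⟨k, hk, rfl⟩ := surjOn_of_injOn_of_card_le y hmaps hinj hcard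
    (show x ∈ ((h \ {u, v} : Finset α) : Set α) by simp [hx, hxu, hxv])
  exact ⟨k, (hmem hk).1, (hmem hk).2.1, (hmem hk).2.2, hyk k hk⟩

lemma eq_pair_union_image (hH : HexadBlock U H) {h : Finset α} (hh : h ∈ H) {u v : α}
    {y : Fin 4 → α} (hu : u ∈ h) (hv : v ∈ h) (hy : ∀ i, y i ∈ h) (huv : u ≠ v)
    (hyinj : Function.Injective y) (hyu : ∀ i, y i ≠ u) (hyv : ∀ i, y i ≠ v) :
    {u, v} ∪ univ.image y = h := by
  refine eq_of_subset_of_card_le (union_subset (insert_subset hu (singleton_subset_iff.2 hv))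
    (image_subset_iff.2 fun i _ => hy i)) ?_
  rw [card_union_of_disjoint, card_pair huv, card_image_of_injective _ hyinj, hH.card_hexad h hh]
  · simp
  · rw [disjoint_right]
    intro z hz
    obtain ⟨i, -, rfl⟩ := mem_image.1 hz
    simp [hyu, hyv]

lemma exists_fin_image {β : Type*} {s : Finset β} {n : ℕ} (hs : s.card = n) :
    ∃ e : Fin n → β, Function.Injective e ∧ ∀ y, y ∈ s ↔ ∃ i, e i = y := by
  let e := (s.equivFinOfCardEq hs).symm
  refine ⟨fun i => e i, fun i j h => e.injective (Subtype.ext h), fun y => ⟨fun hy => ?_, ?_⟩⟩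
  · obtain ⟨i, hi⟩ := e.surjective ⟨y, hy⟩
    exact ⟨i, congrArg Subtype.val hi⟩
  · rintro ⟨i, rfl⟩
    exact (e i).2

lemma exists_frame (hH : HexadBlock U H) :
    ∃ p q t x, Frame H p q t x ∧ ∀ j, t j ∈ U := by
  obtain ⟨p, hp, q, hq, hpq⟩ := one_lt_card.1 (by rw [hH.card_ground]; norm_num : 1 < U.card)
  obtain ⟨h, hinj, hiff⟩ := exists_fin_image (hH.card_through p hp q hq hpq)
  have hh (i) : h i ∈ H ∧ p ∈ h i ∧ q ∈ h i := by
    simpa using (hiff (h i)).2 ⟨i, rfl⟩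
  have hT : 2 < (U \ ({p, q} ∪ univ.biUnion fun i => h i \ {p, q})).card := by
    have h1 := le_card_sdiff ({p, q} ∪ univ.biUnion fun i => h i \ {p, q}) U
    have h2 := card_union_le {p, q} (univ.biUnion fun i => h i \ {p, q})
    have h3 : (univ.biUnion fun i => h i \ {p, q}).card ≤ ∑ i : Fin 4, 4 := by
      refine card_biUnion_le.trans (sum_le_sum fun i _ => ?_)
      rw [card_sdiff_of_subset (insert_subset (hh i).2.1 (singleton_subset_iff.2 (hh i).2.2)),
        card_pair hpq, hH.card_hexad _ (hh i).1]
    rw [card_pair hpq] at h2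
    rw [hH.card_ground] at h1
    simp only [sum_const, card_univ, Fintype.card_fin, smul_eq_mul] at h3
    omega
  obtain ⟨t₀, t₁, t₂, ht₀, ht₁, ht₂, h01, h02, h12⟩ := two_lt_card_iff.1 hT
  set t : Fin 3 → α := ![t₀, t₁, t₂] with ht
  have htmem (j) : t j ∈ U \ ({p, q} ∪ univ.biUnion fun i => h i \ {p, q}) := by
    fin_cases j <;> assumption
  have htU (j) : t j ∈ U := (mem_sdiff.1 (htmem j)).1
  have htp (j) : t j ≠ p := fun e => (mem_sdiff.1 (htmem j)).2 (by simp [e])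
  have htq (j) : t j ≠ q := fun e => (mem_sdiff.1 (htmem j)).2 (by simp [e])
  have htinj : Function.Injective t := by
    intro i j hij
    fin_cases i <;> fin_cases j <;> simp_all [eq_comm]
  have hth (i j) : t j ∉ h i := fun hm => (mem_sdiff.1 (htmem j)).2
    (mem_union_right _ (mem_biUnion.2 ⟨i, mem_univ _, by simp [hm, htp, htq]⟩))
  have hoff : ∀ k ∈ H, p ∈ k → q ∈ k → ∀ j, t j ∉ k := by
    intro k hk hpk hqk j
    obtain ⟨i, rfl⟩ := (hiff k).1 (by simp [hk, hpk, hqk])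
    exact hth i j
  obtain ⟨e, einj, eiff⟩ := exists_fin_image (s := h 0 \ {p, q}) (n := 4) (by
    rw [card_sdiff_of_subset (insert_subset (hh 0).2.1 (singleton_subset_iff.2 (hh 0).2.2)),
        card_pair hpq, hH.card_hexad _ (hh 0).1])
  have he (k) : e k ∈ h 0 ∧ e k ≠ p ∧ e k ≠ q := by
    simpa using (eiff (e k)).2 ⟨k, rfl⟩
  choose W hWH hWp hWt hWe using fun k => hH.exists_hexad_three (hh 0).1 hpq (hh 0).2.1 (hh 0).2.2
    (htU 0) (fun k hk hp hq => hoff k hk hp hq 0) (he k).1 (he k).2.1 (he k).2.2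
  have hne (i k) : h i ≠ W k := fun e => hth i 0 (e ▸ hWt k)
  have hWinj : Function.Injective W := by
    intro k l hkl
    by_contra hkl'
    exact hne 0 l (hH.eq_of_three (hh 0).1 (hWH l) (hh 0).2.1 (he k).1 (he l).1 (hWp l)
      (hkl ▸ hWe k) (hWe l) (he k).2.1.symm (he l).2.1.symm (einj.ne hkl'))
  choose x hxh hxW hxp using fun i k => hH.exists_second (hh i).1 (hWH k) (hne i k) (hh i).2.1
    (hWp k)
  have hxq (i k) : x i k ≠ q := fun e => hoff _ (hWH k) (hWp k) (e ▸ hxW i k) 0 (hWt k)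
  have hxt (i k j) : x i k ≠ t j := fun e => hth i j (e ▸ hxh i k)
  have hxinj {i j k l} (hx : x i k = x j l) : i = j ∧ k = l := by
    constructor
    · exact hinj (hH.eq_of_three (hh i).1 (hh j).1 (hh i).2.1 (hh i).2.2 (hxh i k) (hh j).2.1
        (hh j).2.2 (hx ▸ hxh j l) hpq (hxp i k).symm (hxq i k).symm)
    · exact hWinj (hH.eq_of_three (hWH k) (hWH l) (hWp k) (hWt k) (hxW i k) (hWp l) (hWt l)
        (hx ▸ hxW j l) (htp 0).symm (hxp i k).symm (hxt i k 0).symm)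
  refine ⟨p, q, t, x, ⟨hpq, htinj, htp, htq, hxinj, hxp, hxq, hxt, fun i => ?_, fun k => ?_,
    hoff⟩, htU⟩
  · rw [hH.eq_pair_union_image (hh i).1 (hh i).2.1 (hh i).2.2 (hxh i) hpq
      (fun k l h => (hxinj h).2) (hxp i) (hxq i)]
    exact (hh i).1
  · rw [hH.eq_pair_union_image (hWH k) (hWp k) (hWt k) (fun i => hxW i k) (htp 0).symm
      (fun i j h => (hxinj h).1) (fun i => hxp i k) (fun i => hxt i k 0)]
    exact hWH k

end HexadBlock
end Frame

section Labelling

open Finset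

variable {α : Type*} [DecidableEq α] {U : Finset α} {H : Finset (Finset α)} {p q : α}
  {t : Fin 3 → α} {x : Fin 4 → Fin 4 → α}

lemma mem_pair_union_image {u v z : α} {y : Fin 4 → α} :
    z ∈ ({u, v} : Finset α) ∪ univ.image y ↔ z = u ∨ z = v ∨ ∃ i, y i = z := by
  simp

namespace Frame

/-- The hexads through `p` or `q` and a point `t j` are transversals of the frame. -/
lemma exists_transversal (hH : HexadBlock U H) (F : Frame H p q t x) {h : Finset α} (hh : h ∈ H)
    {u : α} (hu : u = p ∨ u = q) (huh : u ∈ h) {j : Fin 3} (hj : t j ∈ h) :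
    ∃ s : Fin 4 → Fin 4, {u, t j} ∪ univ.image (fun i => x i (s i)) = h := by
  have key (i) : ∃ k, x i k ∈ h := by
    have hne : {p, q} ∪ univ.image (x i) ≠ h := fun e => by
      refine F.off h hh ?_ ?_ j hj <;> rw [← e] <;> simp
    obtain ⟨y, hy, hyh, hyu⟩ := hH.exists_second (F.row i) hh hne
      (by rcases hu with rfl | rfl <;> simp) huh
    rcases mem_pair_union_image.1 hy with rfl | rfl | ⟨k, rfl⟩
    · rcases hu with rfl | rfl
      · exact absurd rfl hyu
      · exact absurd hj (F.off h hh hyh huh j)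
    · rcases hu with rfl | rfl
      · exact absurd hj (F.off h hh huh hyh j)
      · exact absurd rfl hyu
    · exact ⟨k, hyh⟩
  choose s hs using key
  refine ⟨s, hH.eq_pair_union_image hh huh hj hs ?_ (fun i k h => (F.x_inj h).1) ?_ fun i =>
    F.x_ne_t _ _ _⟩
  · rcases hu with rfl | rfl
    · exact (F.t_ne_left j).symm
    · exact (F.t_ne_right j).symm
  · rcases hu with rfl | rfl
    · exact fun i => F.x_ne_left _ _
    · exact fun i => F.x_ne_right _ _

lemma transversal_injective (hH : HexadBlock U H) (F : Frame H p q t x) {j : Fin 3} (hj : j ≠ 0)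
    {s : Fin 4 → Fin 4} (hh : {p, t j} ∪ univ.image (fun i => x i (s i)) ∈ H) :
    Function.Injective s := by
  intro i k hij
  by_contra hne
  have e := hH.eq_of_three (F.col (s i)) hh (x := p) (y := x i (s i)) (z := x k (s k))
    (by simp) (by simp) (mem_pair_union_image.2 (Or.inr (Or.inr ⟨k, by rw [hij]⟩))) (by simp)
    (by simp) (by simp) (F.x_ne_left _ _).symm (F.x_ne_left _ _).symm fun h => hne (F.x_inj h).1
  have ht : t j ∈ {p, t j} ∪ univ.image (fun i => x i (s i)) := by simp
  rw [← e] at ht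
  rcases mem_pair_union_image.1 ht with h | h | ⟨l, h⟩
  · exact F.t_ne_left _ h
  · exact hj (F.t_inj h)
  · exact F.x_ne_t _ _ _ h

lemma exists_diagonal (hH : HexadBlock U H) (F : Frame H p q t x) (htU : ∀ j, t j ∈ U) :
    ∃ σ : Equiv.Perm (Fin 4), {p, t 1} ∪ univ.image (fun i => x i (σ i)) ∈ H := by
  have hp0 : p ∈ {p, q} ∪ univ.image (x 0) := by simp
  have hq0 : q ∈ {p, q} ∪ univ.image (x 0) := by simp
  obtain ⟨h, hh, hp, ht, -⟩ := hH.exists_hexad_three (F.row 0) F.ne hp0 hq0 (htU 1)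
    (fun k hk hp hq => F.off k hk hp hq 1) (x := x 0 0) (by simp) (F.x_ne_left _ _)
    (F.x_ne_right _ _)
  obtain ⟨s, rfl⟩ := F.exists_transversal hH hh (Or.inl rfl) hp ht
  have hs := F.transversal_injective hH (by decide) hh
  exact ⟨Equiv.ofBijective s (Finite.injective_iff_bijective.1 hs), hh⟩

lemma exists_left_transversal (hH : HexadBlock U H) (F : Frame H p q t x) (htU : ∀ j, t j ∈ U)
    (hX : {p, t 1} ∪ univ.image (fun i => x i i) ∈ H) :
    ∃ s : Equiv.Perm (Fin 4), {p, t 2} ∪ univ.image (fun i => x i (s i)) ∈ H ∧ s 0 = 0 ∧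
      ∀ i, i ≠ 0 → s i ≠ i := by
  have hp0 : p ∈ {p, q} ∪ univ.image (x 0) := by simp
  have hq0 : q ∈ {p, q} ∪ univ.image (x 0) := by simp
  obtain ⟨h, hh, hp, ht, hx⟩ := hH.exists_hexad_three (F.row 0) F.ne hp0 hq0 (htU 2)
    (fun k hk hp hq => F.off k hk hp hq 2) (x := x 0 0) (by simp) (F.x_ne_left _ _)
    (F.x_ne_right _ _)
  obtain ⟨s, rfl⟩ := F.exists_transversal hH hh (Or.inl rfl) hp ht
  have hs := F.transversal_injective hH (by decide) hh
  have h0 : s 0 = 0 := by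
    rcases mem_pair_union_image.1 hx with h | h | ⟨k, h⟩
    · exact absurd h (F.x_ne_left _ _)
    · exact absurd h (F.x_ne_t _ _ _)
    · obtain ⟨rfl, h⟩ := F.x_inj h
      exact h
  refine ⟨Equiv.ofBijective s (Finite.injective_iff_bijective.1 hs), hh, h0, fun i hi hsi => ?_⟩
  change s i = i at hsi
  have e := hH.eq_of_three hX hh (x := p) (y := x 0 0) (z := x i i)
    (by simp) (by simp) (by simp) (by simp) hx
    (mem_pair_union_image.2 (Or.inr (Or.inr ⟨i, by rw [hsi]⟩))) (F.x_ne_left _ _).symm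
    (F.x_ne_left _ _).symm fun h => hi (F.x_inj h).1.symm
  rw [← e] at ht
  rcases mem_pair_union_image.1 ht with h | h | ⟨k, h⟩
  · exact F.t_ne_left _ h
  · exact absurd (F.t_inj h) (by decide)
  · exact F.x_ne_t _ _ _ h

lemma exists_right_transversal (hH : HexadBlock U H) (F : Frame H p q t x) (htU : ∀ j, t j ∈ U)
    (hX : {p, t 1} ∪ univ.image (fun i => x i i) ∈ H) :
    ∃ s : Equiv.Perm (Fin 4), {q, t 0} ∪ univ.image (fun i => x i (s i)) ∈ H ∧ s 0 = 0 ∧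
      s ≠ 1 ∧ ∃ i, i ≠ 0 ∧ s i = i := by
  have hp0 : p ∈ {p, q} ∪ univ.image (x 0) := by simp
  have hq0 : q ∈ {p, q} ∪ univ.image (x 0) := by simp
  obtain ⟨h, hh, hq, ht, hx⟩ := hH.exists_hexad_three (F.row 0) F.ne.symm hq0 hp0 (htU 0)
    (fun k hk hq hp => F.off k hk hp hq 0) (x := x 0 0) (by simp) (F.x_ne_right _ _)
    (F.x_ne_left _ _)
  obtain ⟨s, rfl⟩ := F.exists_transversal hH hh (Or.inr rfl) hq ht
  have hp : p ∉ ({q, t 0} : Finset α) ∪ univ.image (fun i => x i (s i)) := fun hp =>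
    F.off _ hh hp hq 0 ht
  have hs : Function.Injective s := by
    intro i j hij
    by_contra hne
    have e := hH.eq_of_three (F.col (s i)) hh (x := t 0) (y := x i (s i)) (z := x j (s j))
      (by simp) (by simp) (mem_pair_union_image.2 (Or.inr (Or.inr ⟨j, by rw [hij]⟩))) (by simp)
      (by simp) (by simp) (F.x_ne_t _ _ _).symm (F.x_ne_t _ _ _).symm fun h => hne (F.x_inj h).1
    rw [← e] at hp
    simp at hp
  have h0 : s 0 = 0 := by
    rcases mem_pair_union_image.1 hx with h | h | ⟨k, h⟩
    · exact absurd h (F.x_ne_right _ _)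
    · exact absurd h (F.x_ne_t _ _ _)
    · obtain ⟨rfl, h⟩ := F.x_inj h
      exact h
  have hne : {p, t 1} ∪ univ.image (fun i => x i i) ≠ {q, t 0} ∪ univ.image fun i => x i (s i) :=
    fun e => hp (by rw [← e]; simp)
  refine ⟨Equiv.ofBijective s (Finite.injective_iff_bijective.1 hs), hh, h0, fun hs1 => ?_, ?_⟩
  · have hs1 (i) : s i = i := DFunLike.congr_fun hs1 i
    have hmem (i) : x i i ∈ ({q, t 0} : Finset α) ∪ univ.image (fun i => x i (s i)) :=
      mem_pair_union_image.2 (Or.inr (Or.inr ⟨i, by rw [hs1]⟩))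
    exact hne (hH.eq_of_three hX hh (x := x 0 0) (y := x 1 1) (z := x 2 2) (by simp) (by simp)
      (by simp) (hmem 0) (hmem 1) (hmem 2) (fun h => absurd (F.x_inj h).1 (by decide))
      (fun h => absurd (F.x_inj h).1 (by decide)) (fun h => absurd (F.x_inj h).1 (by decide)))
  · obtain ⟨y, hyX, hyh, hyx⟩ := hH.exists_second hX hh hne (u := x 0 0) (by simp) hx
    rcases mem_pair_union_image.1 hyX with rfl | rfl | ⟨i, rfl⟩
    · exact absurd hyh hp
    · rcases mem_pair_union_image.1 hyh with h | h | ⟨k, h⟩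
      · exact absurd h (F.t_ne_right _)
      · exact absurd (F.t_inj h) (by decide)
      · exact absurd h (F.x_ne_t _ _ _)
    · refine ⟨i, fun h => hyx (by rw [h]), ?_⟩
      rcases mem_pair_union_image.1 hyh with h | h | ⟨k, h⟩
      · exact absurd h (F.x_ne_right _ _)
      · exact absurd h (F.x_ne_t _ _ _)
      · obtain ⟨rfl, h⟩ := F.x_inj h
        exact h

end Frame

lemma exists_simultaneous_conj (Y Z : Equiv.Perm (Fin 4)) (hY : Y 0 = 0 ∧ ∀ i, i ≠ 0 → Y i ≠ i)
    (hZ : Z 0 = 0 ∧ Z ≠ 1 ∧ ∃ i, i ≠ 0 ∧ Z i = i) :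
    ∃ π : Equiv.Perm (Fin 4), (∀ i, Y (π i) = π (![0, 2, 3, 1] i)) ∧
      ∀ i, Z (π i) = π (![0, 1, 3, 2] i) := by
  revert Y Z
  decide +kernel

/-- The hexads through the first two points, or through the first or second point and one of the
next three points, which generate the hexad code. -/
def labelledHexads : List (List (Fin 21)) :=
  [[0, 1, 5, 6, 7, 8], [0, 1, 9, 10, 11, 12], [0, 1, 13, 14, 15, 16], [0, 1, 17, 18, 19, 20],
    [0, 2, 5, 9, 13, 17], [0, 2, 6, 10, 14, 18], [0, 2, 7, 11, 15, 19],
    [0, 3, 5, 10, 15, 20], [0, 4, 5, 11, 16, 18], [1, 2, 5, 10, 16, 19]]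

/-- The numbering of the points of a frame. -/
def frameLabel (n : Fin 21) : Fin 5 ⊕ Fin 4 × Fin 4 :=
  if h : (n : ℕ) < 5 then Sum.inl ⟨n, h⟩
  else Sum.inr (⟨(n - 5) / 4, by omega⟩, ⟨(n - 5) % 4, by omega⟩)

lemma frameLabel_injective : Function.Injective frameLabel := by
  decide +kernel

lemma HexadBlock.exists_labelling (hH : HexadBlock U H) :
    ∃ f : Fin 21 → α, Function.Injective f ∧
      ∀ l ∈ labelledHexads, (l.map f).toFinset ∈ H := by
  obtain ⟨p, q, t, x, F, htU⟩ := hH.exists_frame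
  obtain ⟨σ, hX⟩ := F.exists_diagonal hH htU
  have F := F.reindex 1 σ
  obtain ⟨Y, hY, hY0, hY1⟩ := F.exists_left_transversal hH htU hX
  obtain ⟨Z, hZ, hZ0, hZ1, hZ2⟩ := F.exists_right_transversal hH htU hX
  obtain ⟨π, hπY, hπZ⟩ := exists_simultaneous_conj Y Z ⟨hY0, hY1⟩ ⟨hZ0, hZ1, hZ2⟩
  set y : Fin 4 → Fin 4 → α := fun i k => x (π i) (σ (π k)) with hy
  have G : Frame H p q t y := F.reindex π π
  have hX' : {p, t 1} ∪ univ.image (fun i => y i i) ∈ H := by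
    rw [image_comp_equiv π fun i => x i (σ i)]
    exact hX
  have hY' : {p, t 2} ∪ univ.image (fun i => y i (![0, 2, 3, 1] i)) ∈ H := by
    simp only [hy, ← hπY]
    rw [image_comp_equiv π fun i => x i (σ (Y i))]
    exact hY
  have hZ' : {q, t 0} ∪ univ.image (fun i => y i (![0, 1, 3, 2] i)) ∈ H := by
    simp only [hy, ← hπZ]
    rw [image_comp_equiv π fun i => x i (σ (Z i))]
    exact hZ
  let g : (Fin 5) ⊕ (Fin 4 × Fin 4) → α := Sum.elim ![p, q, t 0, t 1, t 2] fun i => y i.1 i.2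
  have hg : Function.Injective g := by
    refine Function.Injective.sumElim ?_ (fun i j h => Prod.ext (G.x_inj h).1 (G.x_inj h).2) ?_
    · have h1 := G.t_inj.ne (show (0 : Fin 3) ≠ 1 by decide)
      have h2 := G.t_inj.ne (show (0 : Fin 3) ≠ 2 by decide)
      have h3 := G.t_inj.ne (show (1 : Fin 3) ≠ 2 by decide)
      have h4 := G.ne
      have h5 := G.t_ne_left
      have h6 := G.t_ne_right
      intro i j hij
      fin_cases i <;> fin_cases j <;>
        first
        | rfl
        | exact absurd hij h1
        | exact absurd hij h2
        | exact absurd hij h3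
        | exact absurd hij h4
        | exact absurd hij (h5 _)
        | exact absurd hij (h6 _)
        | exact absurd hij.symm h1
        | exact absurd hij.symm h2
        | exact absurd hij.symm h3
        | exact absurd hij.symm h4
        | exact absurd hij.symm (h5 _)
        | exact absurd hij.symm (h6 _)
    · rintro i ⟨j, k⟩ h
      fin_cases i <;>
        first
        | exact G.x_ne_left j k h.symm
        | exact G.x_ne_right j k h.symm
        | exact G.x_ne_t j k _ h.symm
  have himage (u v : α) (z : Fin 4 → α) :
      ({u, v} : Finset α) ∪ univ.image z = [u, v, z 0, z 1, z 2, z 3].toFinset := by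
    ext w
    simp [Fin.exists_fin_succ, eq_comm]
  have hrow := G.row
  have hcol := G.col
  simp only [himage] at hrow hcol hX' hY' hZ'
  refine ⟨g ∘ frameLabel, hg.comp frameLabel_injective, ?_⟩
  simp only [labelledHexads, List.forall_mem_cons, List.not_mem_nil, false_implies, implies_true,
    and_true]
  exact ⟨hrow 0, hrow 1, hrow 2, hrow 3, hcol 0, hcol 1, hcol 2, hX', hY', hZ'⟩

end Labelling

section BitVectors

open Finset

variable {n : ℕ} {gs : List ℕ} {v : Fin n → ZMod 2}

/-- The binary vector of length `n` formed by the binary digits of `m`. -/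
def vec (n m : ℕ) : Fin n → ZMod 2 := fun i => if m.testBit i then 1 else 0

/-- The number of ones among the `n` lowest binary digits. -/
def pop : ℕ → ℕ → ℕ
  | 0, _ => 0
  | n + 1, m => m % 2 + pop n (m / 2)

/-- All sums (exclusive or) of sublists of a list of bit masks. -/
def spanList : List ℕ → List ℕ
  | [] => [0]
  | g :: gs => spanList gs ++ (spanList gs).map (g ^^^ ·)

/-- The binary code of length `n` generated by a list of bit masks. -/
def codeOf (n : ℕ) (gs : List ℕ) : Submodule (ZMod 2) (Fin n → ZMod 2) :=
  Submodule.span (ZMod 2) {v | ∃ g ∈ gs, vec n g = v}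

lemma vec_apply (m : ℕ) (i : Fin n) : vec n m i = if m.testBit i then 1 else 0 := rfl

lemma vec_eq_one_iff {m : ℕ} {i : Fin n} : vec n m i = 1 ↔ m.testBit i = true := by
  rw [vec_apply]; split_ifs <;> simp_all

lemma vec_eq_zero_iff {m : ℕ} {i : Fin n} : vec n m i = 0 ↔ m.testBit i = false := by
  rw [vec_apply]; split_ifs <;> simp_all

lemma vec_xor (m k : ℕ) : vec n (m ^^^ k) = vec n m + vec n k := by
  ext i
  simp only [vec, Pi.add_apply, Nat.testBit_xor]
  cases m.testBit i <;> cases k.testBit i <;> decide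

lemma vec_zero : vec n 0 = 0 := by
  ext i; simp [vec]

lemma vec_mul (m k : ℕ) (i : Fin n) : vec n m i * vec n k i = vec n (m &&& k) i := by
  simp only [vec, Nat.testBit_and]
  cases m.testBit i <;> cases k.testBit i <;> decide

lemma vec_injOn : Set.InjOn (vec n) {m | m < 2 ^ n} := by
  intro m hm k hk h
  refine Nat.eq_of_testBit_eq fun i => ?_
  by_cases hi : i < n
  · have := congrFun h ⟨i, hi⟩
    simp only [vec_apply] at this
    cases h1 : m.testBit i <;> cases h2 : k.testBit i <;> simp_all
  · have hle : 2 ^ n ≤ 2 ^ i := Nat.pow_le_pow_right (by norm_num) (by omega)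
    rw [Nat.testBit_eq_false_of_lt (lt_of_lt_of_le hm hle),
      Nat.testBit_eq_false_of_lt (lt_of_lt_of_le hk hle)]

lemma pop_eq_sum (n m : ℕ) : pop n m = ∑ i : Fin n, if m.testBit i then 1 else 0 := by
  induction n generalizing m with
  | zero => simp [pop]
  | succ n ih =>
    rw [pop, Fin.sum_univ_succ, ih]
    congr 1
    · rcases Nat.mod_two_eq_zero_or_one m with h | h <;> simp [h, Nat.testBit_zero]
    · simp [Nat.testBit_succ]

lemma wt_vec (m : ℕ) : wt (vec n m) = pop n m := by
  rw [pop_eq_sum, wt, card_filter]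
  refine sum_congr rfl fun i _ => ?_
  rw [vec_apply]
  split_ifs <;> simp_all

lemma sum_vec (m : ℕ) : ∑ i, vec n m i = (pop n m : ZMod 2) := by
  rw [pop_eq_sum]
  push_cast
  rfl

lemma sum_vec_mul (m k : ℕ) : ∑ i, vec n m i * vec n k i = (pop n (m &&& k) : ZMod 2) := by
  simp_rw [vec_mul, sum_vec]

lemma pop_add (a b m : ℕ) : pop (a + b) m = pop a m + pop b (m >>> a) := by
  induction a generalizing m with
  | zero => simp [pop]
  | succ a ih =>
    rw [Nat.succ_add_eq_add_succ, Nat.add_succ, pop, ih, pop, Nat.add_assoc,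
      Nat.shiftRight_succ_inside]

lemma mem_codeOf : v ∈ codeOf n gs ↔ ∃ m ∈ spanList gs, vec n m = v := by
  induction gs generalizing v with
  | nil => simp [codeOf, spanList, vec_zero, eq_comm]
  | cons g gs ih =>
    have hset : {v | ∃ k ∈ g :: gs, vec n k = v} =
        insert (vec n g) {v | ∃ k ∈ gs, vec n k = v} := by
      ext; simp [eq_comm]
    have hspan : v ∈ codeOf n (g :: gs) ↔ ∃ a : ZMod 2, ∃ z ∈ codeOf n gs, v = a • vec n g + z := by
      rw [codeOf, hset, Submodule.mem_span_insert]; rfl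
    rw [hspan]
    simp only [spanList, List.mem_append, List.mem_map]
    constructor
    · rintro ⟨a, z, hz, rfl⟩
      obtain ⟨m, hm, rfl⟩ := ih.1 hz
      obtain rfl | rfl := (by decide : ∀ a : ZMod 2, a = 0 ∨ a = 1) a
      · exact ⟨m, .inl hm, by simp⟩
      · exact ⟨_, .inr ⟨m, hm, rfl⟩, by simp [vec_xor]⟩
    · rintro ⟨_, hm | ⟨m, hm, rfl⟩, rfl⟩
      · exact ⟨0, _, ih.2 ⟨_, hm, rfl⟩, by simp⟩
      · exact ⟨1, _, ih.2 ⟨m, hm, rfl⟩, by simp [vec_xor]⟩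

lemma vec_mem_codeOf {m : ℕ} (hm : m ∈ gs) : vec n m ∈ codeOf n gs :=
  Submodule.subset_span ⟨m, hm, rfl⟩

lemma codeOf_le {D : Submodule (ZMod 2) (Fin n → ZMod 2)} :
    codeOf n gs ≤ D ↔ ∀ g ∈ gs, vec n g ∈ D := by
  rw [codeOf, Submodule.span_le]
  exact ⟨fun h g hg => h ⟨g, hg, rfl⟩, by rintro h _ ⟨g, hg, rfl⟩; exact h g hg⟩

lemma sum_mul_eq_zero_of_mem_codeOf {u : Fin n → ZMod 2}
    (hu : ∀ g ∈ gs, ∑ i, u i * vec n g i = 0) (hv : v ∈ codeOf n gs) : ∑ i, u i * v i = 0 := by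
  induction hv using Submodule.span_induction with
  | mem x hx => obtain ⟨g, hg, rfl⟩ := hx; exact hu g hg
  | zero => simp
  | add x y _ _ hx hy => simp [mul_add, sum_add_distrib, hx, hy]
  | smul a x _ hx => simp [mul_left_comm _ a, ← mul_sum, hx]

lemma mem_spanList_append {gs hs : List ℕ} {m : ℕ} (hm : m ∈ spanList (gs ++ hs)) :
    ∃ u ∈ spanList gs, ∃ v ∈ spanList hs, m = u ^^^ v := by
  induction gs generalizing m with
  | nil => exact ⟨0, by simp [spanList], m, hm, by simp⟩
  | cons g gs ih =>
    simp only [List.cons_append, spanList, List.mem_append, List.mem_map] at hm ⊢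
    rcases hm with hm | ⟨k, hk, rfl⟩
    · obtain ⟨u, hu, v, hv, rfl⟩ := ih hm
      exact ⟨u, .inl hu, v, hv, rfl⟩
    · obtain ⟨u, hu, v, hv, rfl⟩ := ih hk
      exact ⟨g ^^^ u, .inr ⟨u, hu, rfl⟩, v, hv, (Nat.xor_assoc _ _ _).symm⟩

end BitVectors

section Canonical

open Finset

/-- Generators of the `[21, 10, 6]` code spanned by the labelled hexads. -/
def blockGens : List ℕ :=
  [483, 7683, 122883, 1966083, 139813, 279621, 559237, 1082409, 329777, 590886]

/-- The hexads on the first 21 coordinates, extended by the last two coordinates. -/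
def leftGens : List ℕ := blockGens.map fun g => g + 3 * 2 ^ 42

/-- The hexads on the second 21 coordinates, extended by the last two coordinates. -/
def rightGens : List ℕ := blockGens.map fun g => g * 2 ^ 21 + 3 * 2 ^ 42

/-- The all-one word of length 44. -/
def onesMask : ℕ := 2 ^ 44 - 1

/-- A word separating the last two coordinates. -/
def glueMask : ℕ := 6635807375907

/-- Generators of the subcode of index two that does not separate the last two coordinates. -/
def evenGens : List ℕ := leftGens ++ (rightGens ++ [onesMask])

/-- Generators of the canonical code. -/
def codeGens : List ℕ := glueMask :: evenGens

/-- The self-dual `[44, 22, 8]` code to which all others are shown to be equivalent. -/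
def canonicalCode : Submodule (ZMod 2) (Fin 44 → ZMod 2) := codeOf 44 codeGens

/-- The sum of those masks in a list that are selected by the binary digits of `c`. -/
def comb : List ℕ → ℕ → ℕ
  | [], _ => 0
  | g :: gs, c => (if c % 2 = 1 then g else 0) ^^^ comb gs (c / 2)

lemma vec_comb_mem {n : ℕ} (gs : List ℕ) (c : ℕ) : vec n (comb gs c) ∈ codeOf n gs := by
  refine mem_codeOf.2 ⟨_, ?_, rfl⟩
  induction gs generalizing c with
  | nil => simp [comb, spanList]
  | cons g gs ih =>
    rw [comb, spanList, List.mem_append, List.mem_map]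
    split_ifs
    · exact .inr ⟨_, ih _, rfl⟩
    · exact .inl (by simpa using ih _)

/-- An information set of the canonical code whose complement is an information set as well. -/
def infoMask : ℕ := 23049808895

/-- The information set of the pair `infoMask` and its complement that contains `k`. -/
def infoHalf (k : ℕ) : ℕ := if infoMask.testBit k then infoMask else onesMask ^^^ infoMask

/-- The coefficients of the systematic basis words. -/
def basisCoeffs : List ℕ :=
  [4179739, 4179723, 3440434, 3439138, 3439902, 769081, 768105, 769173, 768215, 1064, 1400, 1084,
    1406, 24, 498, 1842, 1738, 34, 1224, 1968, 840, 739328, 722944, 569344, 1896448, 2127900,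
    1292288, 194560, 1116160, 2050, 1089536, 1433600, 1110016, 1437698, 24576, 507906, 3979294,
    3889182, 32770, 1253376, 4110364, 2971676, 2792861, 2792863]

/-- The codeword that has a one at `k` and no other one in the information set containing `k`. -/
def basisWord (k : ℕ) : ℕ := comb codeGens (basisCoeffs.getD k 0)

lemma basisWord_testBit : ∀ k l : Fin 44, (infoHalf k).testBit l = true →
    (basisWord k).testBit l = decide (k = l) := by
  decide +kernel

lemma infoHalf_testBit_self : ∀ k : Fin 44, (infoHalf k).testBit k = true := by
  decide +kernel

lemma infoHalf_testBit : ∀ k l : Fin 44,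
    (infoHalf k).testBit l = (infoMask.testBit k == infoMask.testBit l) := by
  decide +kernel

lemma codeGens_orthogonal : ∀ g ∈ codeGens, ∀ h ∈ codeGens, pop 44 (g &&& h) % 2 = 0 := by
  decide +kernel

lemma sum_codeGens {g h : ℕ} (hg : g ∈ codeGens) (hh : h ∈ codeGens) :
    ∑ i, vec 44 g i * vec 44 h i = 0 := by
  rw [sum_vec_mul, ZMod.natCast_eq_zero_iff]
  exact Nat.dvd_of_mod_eq_zero (codeGens_orthogonal g hg h hh)

lemma canonicalCode_orthogonal {u v : Fin 44 → ZMod 2} (hu : u ∈ canonicalCode)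
    (hv : v ∈ canonicalCode) : ∑ i, u i * v i = 0 := by
  refine sum_mul_eq_zero_of_mem_codeOf (fun g hg => ?_) hv
  simp_rw [mul_comm (u _)]
  refine sum_mul_eq_zero_of_mem_codeOf (fun h hh => ?_) hu
  exact sum_codeGens hg hh

lemma eq_zero_of_orthogonal {w : Fin 44 → ZMod 2}
    (hw : ∀ v ∈ canonicalCode, ∑ i, w i * v i = 0)
    (h0 : ∀ i : Fin 44, infoMask.testBit i = true → w i = 0) : w = 0 := by
  ext k
  by_cases hk : infoMask.testBit k = true
  · exact h0 k hk
  · have := hw _ (vec_comb_mem codeGens (basisCoeffs.getD k 0))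
    rw [sum_eq_single k] at this
    · have h1 : vec 44 (basisWord k) k = 1 := by
        rw [vec_eq_one_iff, basisWord_testBit k k (infoHalf_testBit_self k)]; simp
      rw [← basisWord, h1, mul_one] at this
      exact this
    · intro l _ hl
      by_cases hlI : infoMask.testBit l = true
      · rw [h0 l hlI, zero_mul]
      · have h1 : vec 44 (basisWord k) l = 0 := by
          rw [vec_eq_zero_iff, basisWord_testBit k l]
          · simpa using hl.symm
          · rw [infoHalf_testBit]; simp_all
        rw [← basisWord, h1, mul_zero]
    · simp

lemma exists_mem_canonicalCode (u : Fin 44 → ZMod 2) :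
    ∃ c ∈ canonicalCode, ∀ i : Fin 44, infoMask.testBit i = true → c i = u i := by
  refine ⟨∑ k : Fin 44, (if infoMask.testBit k then u k else 0) • vec 44 (basisWord k),
    Submodule.sum_mem _ fun k _ => Submodule.smul_mem _ _ (vec_comb_mem _ _), fun i hi => ?_⟩
  rw [Finset.sum_apply, sum_eq_single i]
  · have h1 : vec 44 (basisWord i) i = 1 := by
      rw [vec_eq_one_iff, basisWord_testBit i i (infoHalf_testBit_self i)]; simp
    simp [hi, h1]
  · intro k _ hk
    by_cases hkI : infoMask.testBit k = true
    · have h1 : vec 44 (basisWord k) i = 0 := by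
        rw [vec_eq_zero_iff, basisWord_testBit k i]
        · simpa using hk
        · rw [infoHalf_testBit]; simp_all
      simp [h1]
    · simp [hkI]
  · simp

lemma canonicalCode_isSelfDual : isSelfDual canonicalCode := by
  refine fun u => ⟨fun hu v hv => canonicalCode_orthogonal hu hv, fun hu => ?_⟩
  obtain ⟨c, hc, hcu⟩ := exists_mem_canonicalCode u
  have : u - c = 0 := eq_zero_of_orthogonal
    (fun v hv => by simp [sub_mul, sum_sub_distrib, hu v hv, canonicalCode_orthogonal hc hv])
    (fun i hi => by simp [hcu i hi])
  rwa [sub_eq_zero.1 this]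

lemma finrank_canonicalCode : Module.finrank (ZMod 2) canonicalCode = 22 := by
  let r : canonicalCode →ₗ[ZMod 2] ({i : Fin 44 // infoMask.testBit i = true} → ZMod 2) :=
    (LinearMap.funLeft (ZMod 2) (ZMod 2) Subtype.val).comp canonicalCode.subtype
  have hr : Function.Bijective r := by
    refine ⟨(injective_iff_map_eq_zero r).2 fun c hc => Subtype.ext ?_, fun u => ?_⟩
    · refine eq_zero_of_orthogonal (fun v hv => canonicalCode_orthogonal c.2 hv) fun i hi => ?_
      exact congrFun hc ⟨i, hi⟩
    · obtain ⟨c, hc, hcu⟩ := exists_mem_canonicalCode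
        fun i => if h : infoMask.testBit i = true then u ⟨i, h⟩ else 0
      refine ⟨⟨c, hc⟩, funext fun i => ?_⟩
      exact (hcu i i.2).trans (dif_pos i.2)
  rw [(LinearEquiv.ofBijective r hr).finrank_eq, Module.finrank_fintype_fun_eq_card]
  decide +kernel

end Canonical

section Weights

open Finset

/-- The codewords of weight eight of the canonical code. -/
def octadMasks : List ℕ :=
  (spanList leftGens ++ spanList rightGens).filter fun m => pop 44 m = 8

lemma leftGens_words : ∀ u ∈ spanList leftGens, pop 21 (u >>> 21) = 0 ∧
    (u >>> 42 = 0 ∨ u >>> 42 = 3) ∧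
    (u = 0 ∨ pop 21 u = 6 ∧ u >>> 42 = 3 ∨ pop 21 u = 8 ∧ u >>> 42 = 0 ∨
      pop 21 u = 10 ∧ u >>> 42 = 3 ∨ 12 ≤ pop 21 u) ∧
    (pop 21 (u ^^^ onesMask) = 5 ∧ u >>> 42 = 0 ∨ 7 ≤ pop 21 (u ^^^ onesMask)) ∧
    6 ≤ pop 21 (u ^^^ glueMask) ∧ 6 ≤ pop 21 (u ^^^ (glueMask ^^^ onesMask)) := by
  decide +kernel

lemma rightGens_words : ∀ v ∈ spanList rightGens, pop 21 v = 0 ∧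
    (v >>> 42 = 0 ∨ v >>> 42 = 3) ∧
    (v = 0 ∨ pop 21 (v >>> 21) = 6 ∧ v >>> 42 = 3 ∨ pop 21 (v >>> 21) = 8 ∧ v >>> 42 = 0 ∨
      pop 21 (v >>> 21) = 10 ∧ v >>> 42 = 3 ∨ 12 ≤ pop 21 (v >>> 21)) ∧
    (pop 21 ((v ^^^ onesMask) >>> 21) = 5 ∧ v >>> 42 = 0 ∨ 7 ≤ pop 21 ((v ^^^ onesMask) >>> 21)) ∧
    6 ≤ pop 21 ((v ^^^ glueMask) >>> 21) ∧
    6 ≤ pop 21 ((v ^^^ (glueMask ^^^ onesMask)) >>> 21) := by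
  decide +kernel

lemma octadMasks_length : octadMasks.length = 532 := by decide +kernel

lemma octadMasks_nodup : octadMasks.Nodup := by decide +kernel

lemma octadMasks_lt : ∀ m ∈ octadMasks, m < 2 ^ 44 := by decide +kernel

end Weights

section WeightDistribution

open Finset

lemma vec_eq_zero_iff_pop {n m : ℕ} : vec n m = 0 ↔ pop n m = 0 := by
  rw [← wt_vec, wt, card_eq_zero, filter_eq_empty_iff]
  simp [funext_iff]

lemma pop_xor_of_pop_eq_zero {n u v : ℕ} (hv : pop n v = 0) : pop n (u ^^^ v) = pop n u := by
  rw [← wt_vec, vec_xor, vec_eq_zero_iff_pop.2 hv, add_zero, wt_vec]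

lemma exists_decomposition {m : ℕ} (hm : m ∈ spanList codeGens) :
    ∃ u ∈ spanList leftGens, ∃ v ∈ spanList rightGens,
      ∃ z ∈ [0, onesMask, glueMask, glueMask ^^^ onesMask], m = u ^^^ v ^^^ z := by
  have key {k : ℕ} (hk : k ∈ spanList evenGens) : ∃ u ∈ spanList leftGens,
      ∃ v ∈ spanList rightGens, ∃ z, (z = 0 ∨ z = onesMask) ∧ k = u ^^^ v ^^^ z := by
    obtain ⟨u, hu, w, hw, rfl⟩ := mem_spanList_append hk
    obtain ⟨v, hv, z, hz, rfl⟩ := mem_spanList_append hw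
    exact ⟨u, hu, v, hv, z, by simpa [spanList] using hz, (Nat.xor_assoc _ _ _).symm⟩
  rw [codeGens, spanList, List.mem_append, List.mem_map] at hm
  rcases hm with hm | ⟨k, hk, rfl⟩
  · obtain ⟨u, hu, v, hv, z, hz, rfl⟩ := key hm
    exact ⟨u, hu, v, hv, z, by simp; tauto, rfl⟩
  · obtain ⟨u, hu, v, hv, z, hz, rfl⟩ := key hk
    refine ⟨u, hu, v, hv, glueMask ^^^ z, by rcases hz with rfl | rfl <;> simp, ?_⟩
    rw [Nat.xor_left_comm]

lemma pop_decomposition {u v z : ℕ} (hu : u ∈ spanList leftGens) (hv : v ∈ spanList rightGens) :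
    pop 44 (u ^^^ v ^^^ z) = pop 21 (u ^^^ z) + pop 21 ((v ^^^ z) >>> 21) +
      pop 2 (u >>> 42 ^^^ v >>> 42 ^^^ z >>> 42) := by
  have h1 : pop 21 (u ^^^ v ^^^ z) = pop 21 (u ^^^ z) := by
    rw [Nat.xor_right_comm, pop_xor_of_pop_eq_zero (rightGens_words v hv).1]
  have h2 : pop 21 ((u ^^^ v ^^^ z) >>> 21) = pop 21 ((v ^^^ z) >>> 21) := by
    rw [Nat.xor_assoc, Nat.xor_comm, Nat.shiftRight_xor_distrib,
      pop_xor_of_pop_eq_zero (leftGens_words u hu).1]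
  have h3 : (u ^^^ v ^^^ z) >>> (21 + 21) = u >>> 42 ^^^ v >>> 42 ^^^ z >>> 42 := by
    rw [Nat.shiftRight_xor_distrib, Nat.shiftRight_xor_distrib]
  rw [show 44 = 21 + (21 + 2) from rfl, pop_add, pop_add, h1, h2, ← Nat.shiftRight_add, h3,
    ← Nat.add_assoc]

lemma pop_canonical {m : ℕ} (hm : m ∈ spanList codeGens) :
    m = 0 ∨ m ∈ octadMasks ∨ 12 ≤ pop 44 m := by
  obtain ⟨u, hu, v, hv, z, hz, rfl⟩ := exists_decomposition hm
  have hp := pop_decomposition (z := z) hu hv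
  obtain ⟨-, hu1, hu2, hu3, hu4, hu5⟩ := leftGens_words u hu
  obtain ⟨-, hv1, hv2, hv3, hv4, hv5⟩ := rightGens_words v hv
  simp only [List.mem_cons, List.not_mem_nil, or_false] at hz
  rcases hz with rfl | rfl | rfl | rfl
  · simp only [Nat.xor_zero, Nat.zero_shiftRight] at hp ⊢
    rcases eq_or_ne u 0 with rfl | hu0
    · rcases eq_or_ne v 0 with rfl | hv0
      · simp
      · right
        simp only [octadMasks, List.mem_filter, List.mem_append]
        simp only [Nat.zero_xor, Nat.zero_shiftRight] at hp ⊢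
        have h0 : pop 21 0 = 0 := rfl
        rcases hv2 with h | h | h | h | h
        · exact absurd h hv0
        · rw [h.2, h0, show pop 2 3 = 2 from rfl] at hp; left; simp [hv]; omega
        · rw [h.2, h0, show pop 2 0 = 0 from rfl] at hp; left; simp [hv]; omega
        · rw [h.2, h0, show pop 2 3 = 2 from rfl] at hp; right; omega
        · right; omega
    · rcases eq_or_ne v 0 with rfl | hv0
      · right
        simp only [octadMasks, List.mem_filter, List.mem_append]
        simp only [Nat.xor_zero, Nat.zero_shiftRight] at hp ⊢
        have h0 : pop 21 0 = 0 := rfl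
        rcases hu2 with h | h | h | h | h
        · exact absurd h hu0
        · rw [h.2, h0, show pop 2 3 = 2 from rfl] at hp; left; simp [hu]; omega
        · rw [h.2, h0, show pop 2 0 = 0 from rfl] at hp; left; simp [hu]; omega
        · rw [h.2, h0, show pop 2 3 = 2 from rfl] at hp; right; omega
        · right; omega
      · right; right; omega
  · right; right
    have h3 : onesMask >>> 42 = 3 := by decide +kernel
    rw [h3] at hp
    rcases hu3 with ⟨h5, h6⟩ | h7
    · rcases hv3 with ⟨h5', h6'⟩ | h7'
      · rw [h6, h6', show pop 2 (0 ^^^ 0 ^^^ 3) = 2 from rfl] at hp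
        omega
      · omega
    · omega
  · right; right; omega
  · right; right; omega

lemma evenGens_subset : evenGens ⊆ codeGens := List.subset_cons_self _ _

lemma codeOf_mono {n : ℕ} {gs hs : List ℕ} (h : gs ⊆ hs) : codeOf n gs ≤ codeOf n hs :=
  codeOf_le.2 fun _ hg => vec_mem_codeOf (h hg)

lemma leftGens_subset : leftGens ⊆ evenGens := List.subset_append_left _ _

lemma rightGens_subset : rightGens ⊆ evenGens :=
  List.Subset.trans (List.subset_append_left _ _) (List.subset_append_right _ _)

lemma vec_mem_of_mem_octadMasks {m : ℕ} (hm : m ∈ octadMasks) :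
    vec 44 m ∈ canonicalCode ∧ wt (vec 44 m) = 8 := by
  simp only [octadMasks, List.mem_filter, List.mem_append, decide_eq_true_eq] at hm
  refine ⟨?_, by rw [wt_vec, hm.2]⟩
  rcases hm.1 with h | h
  · exact codeOf_mono (List.Subset.trans leftGens_subset evenGens_subset) (mem_codeOf.2 ⟨m, h, rfl⟩)
  · exact codeOf_mono (List.Subset.trans rightGens_subset evenGens_subset)
      (mem_codeOf.2 ⟨m, h, rfl⟩)

lemma mem_canonicalCode_cases {v : Fin 44 → ZMod 2} (hv : v ∈ canonicalCode) :
    v = 0 ∨ (∃ m ∈ octadMasks, vec 44 m = v) ∨ 12 ≤ wt v := by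
  obtain ⟨m, hm, rfl⟩ := mem_codeOf.1 hv
  rw [wt_vec]
  rcases pop_canonical hm with rfl | h | h
  · exact .inl vec_zero
  · exact .inr (.inl ⟨m, h, rfl⟩)
  · exact .inr (.inr h)

lemma mem_canonicalCode_and_wt_iff {v : Fin 44 → ZMod 2} :
    v ∈ canonicalCode ∧ wt v = 8 ↔ ∃ m ∈ octadMasks, vec 44 m = v := by
  constructor
  · rintro ⟨hv, h8⟩
    rcases mem_canonicalCode_cases hv with rfl | h | h
    · simp [wt] at h8
    · exact h
    · omega
  · rintro ⟨m, hm, rfl⟩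
    exact vec_mem_of_mem_octadMasks hm

lemma card_canonicalCode_eight :
    Nat.card {v : Fin 44 → ZMod 2 // v ∈ canonicalCode ∧ wt v = 8} = 532 := by
  have h : {v : Fin 44 → ZMod 2 | v ∈ canonicalCode ∧ wt v = 8} =
      ((octadMasks.toFinset.image (vec 44) : Finset _) : Set (Fin 44 → ZMod 2)) := by
    ext v; simp [mem_canonicalCode_and_wt_iff]
  rw [← Set.coe_ofPred, Nat.card_coe_set_eq, h, Set.ncard_coe_finset, card_image_of_injOn,
    List.toFinset_card_of_nodup octadMasks_nodup, octadMasks_length]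
  refine vec_injOn.mono fun m hm => octadMasks_lt m (by simpa using hm)

lemma eight_le_wt {v : Fin 44 → ZMod 2} (hv : v ∈ canonicalCode) (h0 : v ≠ 0) : 8 ≤ wt v := by
  rcases mem_canonicalCode_cases hv with h | ⟨m, hm, rfl⟩ | h
  · exact absurd h h0
  · exact (vec_mem_of_mem_octadMasks hm).2.ge
  · omega

lemma card_canonicalCode_ten :
    Nat.card {v : Fin 44 → ZMod 2 // v ∈ canonicalCode ∧ wt v = 10} = 0 := by
  rw [Nat.card_eq_zero]
  left
  refine ⟨fun ⟨v, hv, h10⟩ => ?_⟩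
  rcases mem_canonicalCode_cases hv with rfl | ⟨m, hm, rfl⟩ | h
  · simp [wt] at h10
  · rw [(vec_mem_of_mem_octadMasks hm).2] at h10; omega
  · omega

lemma minWtEq_canonicalCode : minWtEq canonicalCode 8 := by
  refine ⟨fun v hv h0 => eight_le_wt hv h0, ?_⟩
  obtain ⟨m, hm⟩ : ∃ m, m ∈ octadMasks :=
    List.exists_mem_of_length_pos (by rw [octadMasks_length]; norm_num)
  obtain ⟨h1, h2⟩ := vec_mem_of_mem_octadMasks hm
  exact ⟨_, h1, by rintro h; rw [h] at h2; simp [wt] at h2, h2⟩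

end WeightDistribution

section Permutations

open Finset

variable {κ : Type*} {C D : Submodule (ZMod 2) (κ → ZMod 2)} {σ τ : Equiv.Perm κ}

lemma mem_permCode {v : κ → ZMod 2} : v ∈ permCode σ C ↔ v ∘ σ.symm ∈ C := by
  constructor
  · rintro ⟨w, hw, rfl⟩
    have : permLM σ w ∘ σ.symm = w := by ext; simp [permLM]
    rwa [this]
  · intro h
    refine ⟨_, h, ?_⟩
    ext; simp [permLM]

lemma comp_mem_permCode {v : κ → ZMod 2} : v ∘ σ ∈ permCode σ C ↔ v ∈ C := by
  rw [mem_permCode]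
  have : (v ∘ σ) ∘ σ.symm = v := by ext; simp
  rw [this]

lemma permCode_permCode : permCode σ (permCode τ C) = permCode (τ * σ) C := by
  ext v; simp only [mem_permCode]; rfl

lemma permCode_one : permCode 1 C = C := by
  ext v; simp only [mem_permCode]; rfl

lemma permCode_inv (h : permCode σ C = D) : permCode σ⁻¹ D = C := by
  rw [← h, permCode_permCode, mul_inv_cancel, permCode_one]

/-- The automorphism group of a code. -/
def autGroup (C : Submodule (ZMod 2) (κ → ZMod 2)) : Subgroup (Equiv.Perm κ) where
  carrier := {σ | permCode σ C = C}
  mul_mem' {σ τ} hσ hτ := by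
    simp only [Set.mem_ofPred_eq] at hσ hτ ⊢
    rw [← permCode_permCode, hσ, hτ]
  one_mem' := permCode_one
  inv_mem' hσ := permCode_inv hσ

lemma mem_autGroup : σ ∈ autGroup C ↔ permCode σ C = C := Iff.rfl

lemma comp_mem_of_mem_autGroup (hσ : σ ∈ autGroup C) {v : κ → ZMod 2} (hv : v ∈ C) :
    v ∘ σ ∈ C := by
  rw [← mem_autGroup.1 hσ]; exact comp_mem_permCode.2 hv

variable [Fintype κ]

lemma wt_comp (v : κ → ZMod 2) : wt (v ∘ σ) = wt v :=
  card_equiv σ (by simp)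

lemma isSelfDual.permCode (hC : isSelfDual C) : isSelfDual (permCode σ C) := by
  intro u
  rw [mem_permCode, hC]
  constructor
  · intro h v hv
    rw [← h _ (mem_permCode.1 hv)]
    exact (Equiv.sum_comp σ.symm fun i => u i * v i).symm
  · intro h v hv
    rw [← h _ (comp_mem_permCode.2 hv), ← Equiv.sum_comp σ]
    simp

lemma isSelfDual.eq_of_le (hC : isSelfDual C) (hD : isSelfDual D) (h : C ≤ D) : C = D :=
  le_antisymm h fun v hv => (hC v).2 fun w hw => (hD v).1 hv w (h hw)

end Permutations

section Glue

open Finset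

/-- The word whose only ones are in the last two coordinates. -/
def lastPair : ℕ := 3 * 2 ^ 42

/-- The transposition of the last two coordinates. -/
def lastSwap : Equiv.Perm (Fin 44) := Equiv.swap 42 43

lemma mem_codeOf_cons {n g : ℕ} {gs : List ℕ} {v : Fin n → ZMod 2} (hv : v ∈ codeOf n (g :: gs)) :
    v ∈ codeOf n gs ∨ ∃ w ∈ codeOf n gs, v = vec n g + w := by
  obtain ⟨m, hm, rfl⟩ := mem_codeOf.1 hv
  rw [spanList, List.mem_append, List.mem_map] at hm
  rcases hm with hm | ⟨k, hk, rfl⟩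
  · exact .inl (mem_codeOf.2 ⟨m, hm, rfl⟩)
  · exact .inr ⟨_, mem_codeOf.2 ⟨k, hk, rfl⟩, vec_xor _ _⟩

lemma lastPair_even : ∀ g ∈ evenGens, pop 44 (lastPair &&& g) % 2 = 0 := by decide +kernel

lemma evenGens_testBit : ∀ g ∈ evenGens, g.testBit 42 = g.testBit 43 := by decide +kernel

lemma vec_glueMask_comp_lastSwap :
    vec 44 glueMask ∘ lastSwap = vec 44 glueMask + vec 44 lastPair := by
  rw [← vec_xor]
  exact funext (by decide +kernel)

lemma sum_lastPair_glueMask : ∑ i, vec 44 lastPair i * vec 44 glueMask i = 1 := by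
  rw [sum_vec_mul]; decide +kernel

lemma wt_lastPair : wt (vec 44 lastPair) = 2 := by rw [wt_vec]; decide +kernel

lemma comp_lastSwap {v : Fin 44 → ZMod 2} (h : v 42 = v 43) : v ∘ lastSwap = v := by
  ext i
  rw [Function.comp_apply, lastSwap, Equiv.swap_apply_def]
  split_ifs with h1 h2
  · rw [h1, h]
  · rw [h2, h]
  · rfl

lemma lastSwap_symm : lastSwap.symm = lastSwap := Equiv.symm_swap _ _

variable {D : Submodule (ZMod 2) (Fin 44 → ZMod 2)}

lemma sum_mul_eq_zero_of_evenGens {v : Fin 44 → ZMod 2} (hv : v ∈ codeOf 44 evenGens) :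
    ∑ i, vec 44 glueMask i * v i = 0 :=
  canonicalCode_orthogonal (vec_mem_codeOf (List.mem_cons_self ..))
    (codeOf_mono evenGens_subset hv)

/-- A self-dual code of minimum weight at least eight that contains the even subcode is, up to a
transposition of the last two coordinates, the canonical code. -/
lemma eq_canonicalCode_or (hD : isSelfDual D) (h8 : ∀ v ∈ D, v ≠ 0 → 8 ≤ wt v)
    (hE : codeOf 44 evenGens ≤ D) : D = canonicalCode ∨ permCode lastSwap D = canonicalCode := by
  have hEgen := codeOf_le.1 hE
  have hpair : vec 44 lastPair ∉ D := fun h => by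
    have := h8 _ h (fun h0 => by have := wt_lastPair; simp [h0, wt] at this)
    rw [wt_lastPair] at this; omega
  by_cases hx : vec 44 glueMask ∈ D
  · left
    refine (canonicalCode_isSelfDual.eq_of_le hD (codeOf_le.2 fun g hg => ?_)).symm
    rcases List.mem_cons.1 hg with rfl | hg
    exacts [hx, hEgen g hg]
  by_cases hxe : vec 44 glueMask + vec 44 lastPair ∈ D
  · right
    refine (canonicalCode_isSelfDual.eq_of_le hD.permCode (codeOf_le.2 fun g hg => ?_)).symm
    rw [mem_permCode, lastSwap_symm]
    rcases List.mem_cons.1 hg with rfl | hg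
    · rwa [vec_glueMask_comp_lastSwap]
    · rw [comp_lastSwap]
      · exact hEgen g hg
      · simp only [vec_apply, Fin.isValue]
        have := evenGens_testBit g hg
        simp_all
  exfalso
  have horth {c : Fin 44 → ZMod 2} (hc : ∀ g ∈ evenGens, ∑ i, c i * vec 44 g i = 0)
      (hcx : ∑ i, c i * vec 44 glueMask i = 0) : c ∈ canonicalCode := by
    refine (canonicalCode_isSelfDual c).2 fun v hv => sum_mul_eq_zero_of_mem_codeOf ?_ hv
    intro g hg
    rcases List.mem_cons.1 hg with rfl | hg
    exacts [hcx, hc g hg]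
  have heven {c : Fin 44 → ZMod 2} (hc : c ∈ D) (g : ℕ) (hg : g ∈ evenGens) :
      ∑ i, c i * vec 44 g i = 0 := (hD c).1 hc _ (hEgen g hg)
  have hDE : D ≤ codeOf 44 evenGens := by
    intro c hc
    rcases (by decide : ∀ a : ZMod 2, a = 0 ∨ a = 1) (∑ i, c i * vec 44 glueMask i) with h | h
    · rcases mem_codeOf_cons (horth (heven hc) h) with h | ⟨w, hw, rfl⟩
      · exact h
      · exact absurd ((Submodule.add_mem_iff_left _ (hE hw)).1 hc) hx
    · have h2 : c + vec 44 lastPair ∈ canonicalCode := by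
        refine horth (fun g hg => ?_) ?_
        · simp only [Pi.add_apply, add_mul, sum_add_distrib, heven hc g hg, zero_add]
          rw [sum_vec_mul, ZMod.natCast_eq_zero_iff]
          exact Nat.dvd_of_mod_eq_zero (lastPair_even g hg)
        · simp only [Pi.add_apply, add_mul, sum_add_distrib, h, sum_lastPair_glueMask]
          decide
      rcases mem_codeOf_cons h2 with h | ⟨w, hw, h⟩
      · exact absurd ((Submodule.add_mem_iff_right _ hc).1 (hE h)) hpair
      · refine absurd ?_ hxe
        have h3 : vec 44 glueMask + vec 44 lastPair = c - w := by
          have h4 : vec 44 lastPair + vec 44 lastPair = 0 := by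
            rw [← vec_xor, Nat.xor_self, vec_zero]
          rw [eq_sub_iff_add_eq, add_right_comm, ← h, add_assoc, h4, add_zero]
        rw [h3]
        exact Submodule.sub_mem _ hc (hE hw)
  exact hx ((hD _).2 fun v hv => sum_mul_eq_zero_of_evenGens (hDE hv))

end Glue

section Words

open Finset

variable {κ : Type*} [Fintype κ] [DecidableEq κ]

/-- The correspondence between sets of coordinates and binary vectors. -/
def indicator : Finset κ ≃ (κ → ZMod 2) where
  toFun J i := if i ∈ J then 1 else 0
  invFun v := univ.filter fun i => v i ≠ 0
  left_inv J := by ext; simp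
  right_inv v := by
    ext i
    have := (by decide : ∀ a : ZMod 2, a = 0 ∨ a = 1) (v i)
    rcases this with h | h <;> simp [h]

lemma indicator_apply (J : Finset κ) (i : κ) : indicator J i = if i ∈ J then 1 else 0 := rfl

lemma wt_indicator (J : Finset κ) : wt (indicator J) = J.card := by
  simp [wt, indicator_apply]

lemma sum_indicator_mul (J K : Finset κ) :
    ∑ i, indicator J i * indicator K i = ((J ∩ K).card : ZMod 2) := by
  simp only [indicator_apply, ite_mul, one_mul, zero_mul, sum_ite_mem, univ_inter]
  simp

open Classical in
/-- The supports of the words of a code. -/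
noncomputable def words (D : Submodule (ZMod 2) (κ → ZMod 2)) : Finset (Finset κ) :=
  univ.filter fun J => indicator J ∈ D

variable {D : Submodule (ZMod 2) (κ → ZMod 2)}

lemma mem_words {J : Finset κ} : J ∈ words D ↔ indicator J ∈ D := by simp [words]

lemma selfDual_words (hD : isSelfDual D) : SelfDual (words D) := by
  intro J
  rw [mem_words, hD]
  constructor
  · intro h c hc
    have := h _ (mem_words.1 hc)
    rwa [sum_indicator_mul, ZMod.natCast_eq_zero_iff, ← even_iff_two_dvd] at this
  · intro h v hv
    obtain ⟨c, rfl⟩ := indicator.surjective v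
    rw [sum_indicator_mul, ZMod.natCast_eq_zero_iff, ← even_iff_two_dvd]
    exact h c (mem_words.2 hv)

lemma card_filter_words (n : ℕ) :
    {c ∈ words D | c.card = n}.card = Nat.card {v : κ → ZMod 2 // v ∈ D ∧ wt v = n} := by
  have h : Nat.card {J : Finset κ // J ∈ words D ∧ J.card = n} =
      Nat.card {v : κ → ZMod 2 // v ∈ D ∧ wt v = n} :=
    Nat.card_congr (indicator.subtypeEquiv fun J => by rw [mem_words, wt_indicator])
  rw [← h, Nat.subtype_card _ fun J => mem_filter]

lemma card_words : (words D).card = 2 ^ Module.finrank (ZMod 2) D := by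
  classical
  have := Module.card_eq_pow_finrank (K := ZMod 2) (V := D)
  rw [ZMod.card] at this
  rw [← this, ← Fintype.card_coe]
  exact Fintype.card_congr (indicator.subtypeEquiv fun J => mem_words)

lemma targetCode.isTarget {D : Submodule (ZMod 2) (Fin 44 → ZMod 2)} (hD : targetCode D) :
    IsTarget (words D) := by
  obtain ⟨h1, h2, h3, -, h4, h5⟩ := hD
  refine ⟨selfDual_words h1, by rw [card_words, h2], fun c hc h0 => ?_, ?_, fun c hc h10 => ?_⟩
  · rw [← wt_indicator]
    refine h3.1 _ (mem_words.1 hc) fun h => h0 (indicator.injective ?_)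
    rw [h]; ext; simp [indicator_apply]
  · rw [card_filter_words, h4]
  · rw [← card_filter_words, card_eq_zero, filter_eq_empty_iff] at h5
    exact h5 hc h10

end Words

section Uniqueness

open Finset

variable {α : Type*}

/-- The `i`-th coordinate of the left block. -/
def leftPt (i : Fin 21) : Fin 44 := ⟨i, by omega⟩

/-- The `i`-th coordinate of the right block. -/
def rightPt (i : Fin 21) : Fin 44 := ⟨21 + i, by omega⟩

/-- The function on the coordinates with given restrictions to the two blocks and given values at
the last two coordinates. -/
def glue (f g : Fin 21 → α) (a b : α) (z : Fin 44) : α :=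
  if h : z.val < 21 then f ⟨z, h⟩
  else if h : z.val < 42 then g ⟨z - 21, by omega⟩
  else if z = 42 then a else b

lemma forall_coordinates {P : Fin 44 → Prop} (hl : ∀ i, P (leftPt i)) (hr : ∀ i, P (rightPt i))
    (ha : P 42) (hb : P 43) (z : Fin 44) : P z := by
  by_cases h : z.val < 21
  · exact hl ⟨z, h⟩
  by_cases h' : z.val < 42
  · convert hr ⟨z - 21, by omega⟩
    exact Fin.ext (by simp [rightPt]; omega)
  by_cases h42 : z = 42
  · exact h42 ▸ ha
  · have : z = 43 := by
      refine Fin.ext ?_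
      have : z.val ≠ 42 := fun h => h42 (Fin.ext h)
      simp; omega
    exact this ▸ hb

variable {f g : Fin 21 → α} {a b : α}

@[simp] lemma glue_leftPt (i : Fin 21) : glue f g a b (leftPt i) = f i := by
  simp [glue, leftPt]

@[simp] lemma glue_rightPt (i : Fin 21) : glue f g a b (rightPt i) = g i := by
  have h : 21 + i.val < 42 := by omega
  simp [glue, rightPt, h]

@[simp] lemma glue_42 : glue f g a b 42 = a := by simp [glue]

@[simp] lemma glue_43 : glue f g a b 43 = b := by simp [glue]

lemma leftPt_injective : Function.Injective leftPt := fun i j h => by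
  simpa [leftPt, Fin.ext_iff] using h

lemma rightPt_injective : Function.Injective rightPt := fun i j h => by
  simpa [rightPt, Fin.ext_iff] using h

lemma glue_injective (hf : Function.Injective f) (hg : Function.Injective g)
    (hfg : ∀ i j, f i ≠ g j) (hab : a ≠ b) (hfa : ∀ i, f i ≠ a) (hfb : ∀ i, f i ≠ b)
    (hga : ∀ i, g i ≠ a) (hgb : ∀ i, g i ≠ b) : Function.Injective (glue f g a b) := by
  suffices H : ∀ y z, glue f g a b y = glue f g a b z → y = z from fun y z => H y z
  refine forall_coordinates (fun i => ?_) (fun i => ?_) ?_ ?_ <;>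
  refine forall_coordinates (fun j => ?_) (fun j => ?_) ?_ ?_ <;>
  simp only [glue_leftPt, glue_rightPt, glue_42, glue_43] <;> intro h
  · rw [hf h]
  · exact absurd h (hfg _ _)
  · exact absurd h (hfa _)
  · exact absurd h (hfb _)
  · exact absurd h.symm (hfg _ _)
  · rw [hg h]
  · exact absurd h (hga _)
  · exact absurd h (hgb _)
  · exact absurd h.symm (hfa _)
  · exact absurd h.symm (hga _)
  · trivial
  · exact absurd h hab
  · exact absurd h.symm (hfb _)
  · exact absurd h.symm (hgb _)
  · exact absurd h.symm hab
  · trivial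

lemma leftGens_labelled : ∀ m ∈ leftGens, ∃ l ∈ labelledHexads,
    (∀ i : Fin 21, m.testBit (leftPt i) = decide (i ∈ l)) ∧
    (∀ i : Fin 21, m.testBit (rightPt i) = false) ∧ m.testBit 42 = true ∧ m.testBit 43 = true := by
  decide +kernel

lemma rightGens_labelled : ∀ m ∈ rightGens, ∃ l ∈ labelledHexads,
    (∀ i : Fin 21, m.testBit (rightPt i) = decide (i ∈ l)) ∧
    (∀ i : Fin 21, m.testBit (leftPt i) = false) ∧ m.testBit 42 = true ∧ m.testBit 43 = true := by
  decide +kernel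

lemma exists_labelledHexad_mem : ∀ i : Fin 21, ∃ l ∈ labelledHexads, i ∈ l := by decide +kernel

lemma one_mem_of_isSelfDual {κ : Type*} [Fintype κ] {D : Submodule (ZMod 2) (κ → ZMod 2)}
    (hD : isSelfDual D) : (fun _ => 1) ∈ D := by
  refine (hD _).2 fun v hv => ?_
  rw [← (hD v).1 hv v hv]
  refine sum_congr rfl fun i _ => ?_
  exact (by decide : ∀ a : ZMod 2, 1 * a = a * a) (v i)

lemma vec_onesMask : vec 44 onesMask = fun _ => 1 := funext (by decide +kernel)

lemma codeOf_evenGens_le {D : Submodule (ZMod 2) (Fin 44 → ZMod 2)} (hD : isSelfDual D)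
    (hl : ∀ m ∈ leftGens, vec 44 m ∈ D) (hr : ∀ m ∈ rightGens, vec 44 m ∈ D) :
    codeOf 44 evenGens ≤ D := by
  refine codeOf_le.2 fun m hm => ?_
  simp only [evenGens, List.mem_append, List.mem_singleton] at hm
  rcases hm with hm | hm | rfl
  · exact hl m hm
  · exact hr m hm
  · rw [vec_onesMask]; exact one_mem_of_isSelfDual hD

/-- Every code in the target class is equivalent to the canonical code. -/
lemma targetCode.exists_equiv {D : Submodule (ZMod 2) (Fin 44 → ZMod 2)} (hD : targetCode D) :
    ∃ φ : Equiv.Perm (Fin 44), permCode φ D = canonicalCode := by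
  obtain ⟨a, b, hab, hsh⟩ := hD.isTarget.exists_shadow_pair
  have hP : IsPair (words D) a b := { hD.isTarget with ne := hab, shadow := hsh }
  have hH := hP.hexadSystem
  obtain ⟨p, hp⟩ := card_pos.1 (by rw [hH.card_ground]; norm_num : 0 < ({a, b}ᶜ : Finset _).card)
  obtain ⟨r, hr, -, -, hdisj⟩ := hH.exists_disjoint_block hp
  have main {q : Fin 44} (hq : q ∈ ({a, b}ᶜ : Finset (Fin 44))) : ∃ f : Fin 21 → Fin 44,
      Function.Injective f ∧ (∀ l ∈ labelledHexads, (l.map f).toFinset ∈ hexads (words D) a b) ∧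
      ∀ i, f i ∈ block {a, b}ᶜ (hexads (words D) a b) q := by
    obtain ⟨f, hf, hfl⟩ := (hH.hexadBlock hq).exists_labelling
    refine ⟨f, hf, fun l hl => (mem_filter.1 (hfl l hl)).1, fun i => ?_⟩
    obtain ⟨l, hl, hi⟩ := exists_labelledHexad_mem i
    exact (mem_filter.1 (hfl l hl)).2 (List.mem_toFinset.2 (List.mem_map_of_mem hi))
  obtain ⟨f, hf, hfl, hfU⟩ := main hp
  obtain ⟨g, hg, hgl, hgV⟩ := main hr
  have hne {q : Fin 44} {f : Fin 21 → Fin 44}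
      (hf : ∀ i, f i ∈ block {a, b}ᶜ (hexads (words D) a b) q) (i : Fin 21) :
      f i ≠ a ∧ f i ≠ b := by
    simpa using (mem_filter.1 (hf i)).1
  have hfg (i j : Fin 21) : f i ≠ g j := fun h =>
    disjoint_left.1 hdisj (hfU i) (h ▸ hgV j)
  have hinj : Function.Injective (glue f g a b) :=
    glue_injective hf hg hfg hab (fun i => (hne hfU i).1) (fun i => (hne hfU i).2)
      (fun i => (hne hgV i).1) fun i => (hne hgV i).2
  set φ : Equiv.Perm (Fin 44) :=
    Equiv.ofBijective _ (Finite.injective_iff_bijective.1 hinj) with hφ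
  have hφz (z : Fin 44) : φ z = glue f g a b z := rfl
  have hsd : isSelfDual (permCode φ D) := hD.1.permCode
  have hvec {m : ℕ} {J : Finset (Fin 44)} (hJ : J ∈ hexads (words D) a b)
      (h : ∀ z : Fin 44, m.testBit z = true ↔ φ z ∈ J ∪ {a, b}) : vec 44 m ∈ permCode φ D := by
    have : vec 44 m = indicator (J ∪ {a, b}) ∘ φ := by
      ext z
      rw [vec_apply, Function.comp_apply, indicator_apply]
      simp only [h]
    rw [this]
    exact comp_mem_permCode.2 (mem_words.1 (mem_hexads.1 hJ).2.2)
  have hE : codeOf 44 evenGens ≤ permCode φ D := by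
    refine codeOf_evenGens_le hsd (fun m hm => ?_) fun m hm => ?_
    · obtain ⟨l, hl, h1, h2, h3, h4⟩ := leftGens_labelled m hm
      refine hvec (hfl l hl) (forall_coordinates (fun i => ?_) (fun i => ?_) ?_ ?_)
      · simp [hφz, h1, hne hfU, hf.eq_iff]
      · simp [hφz, h2, hne hgV, hfg]
      · simp [hφz, h3]
      · simp [hφz, h4]
    · obtain ⟨l, hl, h1, h2, h3, h4⟩ := rightGens_labelled m hm
      refine hvec (hgl l hl) (forall_coordinates (fun i => ?_) (fun i => ?_) ?_ ?_)
      · simp [hφz, h2, hne hfU, fun i j => (hfg i j).symm]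
      · simp [hφz, h1, hne hgV, hg.eq_iff]
      · simp [hφz, h3]
      · simp [hφz, h4]
  have h8 : ∀ v ∈ permCode φ D, v ≠ 0 → 8 ≤ wt v := by
    rintro _ ⟨v, hv, rfl⟩ h0
    have : wt (v ∘ φ) = wt v := wt_comp v
    refine this ▸ hD.2.2.1.1 v hv ?_
    rintro rfl
    exact h0 (map_zero _)
  rcases eq_canonicalCode_or hsd h8 hE with h | h
  · exact ⟨φ, h⟩
  · exact ⟨_, permCode_permCode ▸ h⟩

end Uniqueness

section BlockCode

open Finset

/-- The `[21, 10, 6]` code spanned by the labelled hexads. -/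
def blockCode : Submodule (ZMod 2) (Fin 21 → ZMod 2) := codeOf 21 blockGens

variable {v : Fin 44 → ZMod 2}

lemma leftGens_testBit : ∀ h ∈ blockGens, ∀ i : Fin 21,
    (h + 3 * 2 ^ 42).testBit (leftPt i) = h.testBit i := by decide +kernel

lemma rightGens_testBit : ∀ h ∈ blockGens, ∀ i : Fin 21,
    (h * 2 ^ 21 + 3 * 2 ^ 42).testBit (rightPt i) = h.testBit i := by decide +kernel

lemma map_codeOf {n k : ℕ} (p : Fin k → Fin n) (f : ℕ → ℕ) {gs : List ℕ}
    (h : ∀ m ∈ gs, ∀ i : Fin k, (f m).testBit (p i) = m.testBit i) :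
    (codeOf n (gs.map f)).map (LinearMap.funLeft (ZMod 2) (ZMod 2) p) = codeOf k gs := by
  rw [codeOf, Submodule.map_span, codeOf]
  have key (m : ℕ) (hm : m ∈ gs) : vec n (f m) ∘ p = vec k m := by
    ext i
    simp only [Function.comp_apply, vec_apply, h m hm i]
  congr 1
  ext w
  simp only [List.mem_map, Set.mem_image]
  constructor
  · rintro ⟨_, ⟨_, ⟨m, hm, rfl⟩, rfl⟩, rfl⟩
    exact ⟨m, hm, (key m hm).symm⟩
  · rintro ⟨m, hm, rfl⟩
    exact ⟨_, ⟨_, ⟨m, hm, rfl⟩, rfl⟩, key m hm⟩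

lemma mem_blockCode_iff_left {b : Fin 21 → ZMod 2} :
    b ∈ blockCode ↔ ∃ v ∈ codeOf 44 leftGens, v ∘ leftPt = b := by
  rw [blockCode, ← map_codeOf leftPt _ leftGens_testBit]; rfl

lemma mem_blockCode_iff_right {b : Fin 21 → ZMod 2} :
    b ∈ blockCode ↔ ∃ v ∈ codeOf 44 rightGens, v ∘ rightPt = b := by
  rw [blockCode, ← map_codeOf rightPt _ rightGens_testBit]; rfl

lemma pop_eq_zero_of_left {m : ℕ} (h : ∀ i, vec 44 m (leftPt i) = 0) : pop 21 m = 0 := by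
  rw [← vec_eq_zero_iff_pop]
  exact funext h

lemma pop_eq_zero_of_right {m : ℕ} (h : ∀ i, vec 44 m (rightPt i) = 0) :
    pop 21 (m >>> 21) = 0 := by
  rw [← vec_eq_zero_iff_pop]
  ext i
  simpa [vec_apply, Nat.testBit_shiftRight, rightPt] using h i

lemma right_eq_zero (hv : v ∈ codeOf 44 leftGens) (i : Fin 21) : v (rightPt i) = 0 := by
  obtain ⟨u, hu, rfl⟩ := mem_codeOf.1 hv
  have := congrFun (vec_eq_zero_iff_pop.2 (leftGens_words u hu).1) i
  simpa [vec_apply, Nat.testBit_shiftRight, rightPt] using this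

lemma left_eq_zero (hv : v ∈ codeOf 44 rightGens) (i : Fin 21) : v (leftPt i) = 0 := by
  obtain ⟨u, hu, rfl⟩ := mem_codeOf.1 hv
  exact congrFun (vec_eq_zero_iff_pop.2 (rightGens_words u hu).1) i

lemma mem_left_of_right_eq_zero (hv : v ∈ canonicalCode) (h : ∀ i, v (rightPt i) = 0) :
    v ∈ codeOf 44 leftGens := by
  obtain ⟨m, hm, rfl⟩ := mem_codeOf.1 hv
  have h0 := pop_eq_zero_of_right h
  obtain ⟨u, hu, w, hw, z, hz, rfl⟩ := exists_decomposition hm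
  rw [Nat.xor_assoc, Nat.xor_comm, Nat.shiftRight_xor_distrib,
    pop_xor_of_pop_eq_zero (leftGens_words u hu).1] at h0
  obtain ⟨-, -, h2, h3, h4, h5⟩ := rightGens_words w hw
  simp only [List.mem_cons, List.not_mem_nil, or_false] at hz
  rcases hz with rfl | rfl | rfl | rfl
  · rw [Nat.xor_zero] at h0
    obtain rfl : w = 0 := by omega
    exact mem_codeOf.2 ⟨u, hu, by simp⟩
  all_goals omega

lemma mem_right_of_left_eq_zero (hv : v ∈ canonicalCode) (h : ∀ i, v (leftPt i) = 0) :
    v ∈ codeOf 44 rightGens := by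
  obtain ⟨m, hm, rfl⟩ := mem_codeOf.1 hv
  have h0 := pop_eq_zero_of_left h
  obtain ⟨u, hu, w, hw, z, hz, rfl⟩ := exists_decomposition hm
  rw [Nat.xor_right_comm, pop_xor_of_pop_eq_zero (rightGens_words w hw).1] at h0
  obtain ⟨-, -, h2, h3, h4, h5⟩ := leftGens_words u hu
  simp only [List.mem_cons, List.not_mem_nil, or_false] at hz
  rcases hz with rfl | rfl | rfl | rfl
  · rw [Nat.xor_zero] at h0
    obtain rfl : u = 0 := by omega
    exact mem_codeOf.2 ⟨w, hw, by simp⟩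
  all_goals omega

lemma codeOf_leftGens_le : codeOf 44 leftGens ≤ canonicalCode :=
  codeOf_mono (List.Subset.trans leftGens_subset evenGens_subset)

lemma codeOf_rightGens_le : codeOf 44 rightGens ≤ canonicalCode :=
  codeOf_mono (List.Subset.trans rightGens_subset evenGens_subset)

lemma last_eq (hv : v ∈ codeOf 44 evenGens) : v 42 = v 43 := by
  have h : codeOf 44 evenGens ≤
      LinearMap.ker (LinearMap.proj (R := ZMod 2) (φ := fun _ => ZMod 2) (42 : Fin 44) -
        LinearMap.proj (43 : Fin 44)) := by
    refine codeOf_le.2 fun g hg => ?_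
    have := evenGens_testBit g hg
    simp only [LinearMap.mem_ker, LinearMap.sub_apply, LinearMap.proj_apply, vec_apply, sub_eq_zero]
    simp_all
  have := h hv
  simpa [sub_eq_zero] using this

end BlockCode

section Linked

open Finset

/-- Two coordinates are linked if some codeword of weight eight contains both of them. -/
def Linked (x y : Fin 44) : Prop := ∃ v ∈ canonicalCode, wt v = 8 ∧ v x = 1 ∧ v y = 1

lemma Linked.symm {x y : Fin 44} (h : Linked x y) : Linked y x := by
  obtain ⟨v, h1, h2, h3, h4⟩ := h
  exact ⟨v, h1, h2, h4, h3⟩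

lemma linked_apply_iff {σ : Equiv.Perm (Fin 44)} (hσ : σ ∈ autGroup canonicalCode) {x y : Fin 44} :
    Linked (σ x) (σ y) ↔ Linked x y := by
  have key {σ : Equiv.Perm (Fin 44)} (hσ : σ ∈ autGroup canonicalCode) {x y : Fin 44}
      (h : Linked (σ x) (σ y)) : Linked x y := by
    obtain ⟨v, h1, h2, h3, h4⟩ := h
    exact ⟨_, comp_mem_of_mem_autGroup hσ h1, (wt_comp v).trans h2, h3, h4⟩
  refine ⟨key hσ, fun h => key (inv_mem hσ) ?_⟩
  simpa using h

lemma gens_pop : ∀ m ∈ leftGens ++ rightGens, pop 44 m = 8 := by decide +kernel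

lemma linked_of_testBit {m : ℕ} (hm : m ∈ leftGens ++ rightGens) {x y : Fin 44}
    (hx : m.testBit x = true) (hy : m.testBit y = true) : Linked x y := by
  refine ⟨vec 44 m, ?_, by rw [wt_vec, gens_pop m hm], vec_eq_one_iff.2 hx, vec_eq_one_iff.2 hy⟩
  rcases List.mem_append.1 hm with h | h
  · exact codeOf_leftGens_le (vec_mem_codeOf h)
  · exact codeOf_rightGens_le (vec_mem_codeOf h)

lemma linked_left (i : Fin 21) : Linked (leftPt 0) (leftPt i) := by
  have : ∀ i : Fin 21, ∃ m ∈ leftGens ++ rightGens,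
      m.testBit (leftPt 0) = true ∧ m.testBit (leftPt i) = true := by decide +kernel
  obtain ⟨m, hm, h1, h2⟩ := this i
  exact linked_of_testBit hm h1 h2

lemma linked_last (x : Fin 44) : Linked 42 x ∧ Linked 43 x := by
  have : ∀ x : Fin 44, ∃ m ∈ leftGens ++ rightGens,
      m.testBit x = true ∧ m.testBit 42 = true ∧ m.testBit 43 = true := by decide +kernel
  obtain ⟨m, hm, h1, h2, h3⟩ := this x
  exact ⟨linked_of_testBit hm h2 h1, linked_of_testBit hm h3 h1⟩

lemma not_linked (i j : Fin 21) : ¬ Linked (leftPt i) (rightPt j) := by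
  rintro ⟨v, hv, h8, h1, h2⟩
  obtain ⟨m, hm, rfl⟩ := mem_canonicalCode_and_wt_iff.1 ⟨hv, h8⟩
  simp only [octadMasks, List.mem_filter, List.mem_append] at hm
  rcases hm.1 with h | h
  · rw [right_eq_zero (mem_codeOf.2 ⟨m, h, rfl⟩)] at h2; exact zero_ne_one h2
  · rw [left_eq_zero (mem_codeOf.2 ⟨m, h, rfl⟩)] at h1; exact zero_ne_one h1

lemma forall_linked_iff {x : Fin 44} : (∀ y, Linked x y) ↔ x = 42 ∨ x = 43 := by
  constructor
  · refine forall_coordinates (P := fun x => (∀ y, Linked x y) → x = 42 ∨ x = 43)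
      (fun i h => ?_) (fun i h => ?_) (fun _ => .inl rfl) (fun _ => .inr rfl) x
    · exact absurd (h _) (not_linked i 0)
    · exact absurd (h _).symm (not_linked 0 i)
  · rintro (rfl | rfl) y
    exacts [(linked_last y).1, (linked_last y).2]

lemma apply_last_iff {σ : Equiv.Perm (Fin 44)} (hσ : σ ∈ autGroup canonicalCode) {x : Fin 44} :
    (σ x = 42 ∨ σ x = 43) ↔ (x = 42 ∨ x = 43) := by
  rw [← forall_linked_iff, ← forall_linked_iff]
  refine ⟨fun h y => (linked_apply_iff hσ).1 (h _), fun h y => ?_⟩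
  obtain ⟨z, rfl⟩ := σ.surjective y
  exact (linked_apply_iff hσ).2 (h z)

lemma leftPt_ne_rightPt (i j : Fin 21) : leftPt i ≠ rightPt j := by
  simp only [leftPt, rightPt, ne_eq, Fin.mk.injEq]; omega

lemma leftPt_ne_last (i : Fin 21) : ¬ (leftPt i = 42 ∨ leftPt i = 43) := by
  simp only [leftPt, Fin.ext_iff]; omega

lemma rightPt_ne_last (i : Fin 21) : ¬ (rightPt i = 42 ∨ rightPt i = 43) := by
  simp only [rightPt, Fin.ext_iff]; omega

lemma exists_leftPt_or_rightPt {x : Fin 44} (h : ¬ (x = 42 ∨ x = 43)) :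
    (∃ j, x = leftPt j) ∨ ∃ j, x = rightPt j := by
  revert h
  exact forall_coordinates
    (P := fun x => ¬ (x = 42 ∨ x = 43) → (∃ j, x = leftPt j) ∨ ∃ j, x = rightPt j)
    (fun i _ => .inl ⟨i, rfl⟩) (fun i _ => .inr ⟨i, rfl⟩) (by simp) (by simp) x

end Linked

section Automorphisms

open Finset

lemma mem_autGroup_of_comp_mem {κ : Type*} [Fintype κ] {σ : Equiv.Perm κ}
    {C : Submodule (ZMod 2) (κ → ZMod 2)} (h : ∀ v ∈ C, v ∘ σ ∈ C) : σ ∈ autGroup C := by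
  rw [mem_autGroup]
  refine Submodule.eq_of_le_of_finrank_eq ?_ ?_
  · rintro _ ⟨v, hv, rfl⟩
    exact h v hv
  · exact (Submodule.equivMapOfInjective (permLM σ)
      (fun _ _ => (σ.surjective.injective_comp_right ·)) C).symm.finrank_eq

lemma exists_mem_autGroup {φ : Equiv.Perm (Fin 44)}
    (hE : codeOf 44 evenGens ≤ permCode φ canonicalCode) :
    ∃ τ ∈ autGroup canonicalCode, ∀ z, z ≠ 42 → z ≠ 43 → τ z = φ z := by
  have h8 : ∀ v ∈ permCode φ canonicalCode, v ≠ 0 → 8 ≤ wt v := by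
    rintro _ ⟨v, hv, rfl⟩ h0
    have : wt (v ∘ φ) = wt v := wt_comp v
    refine this ▸ eight_le_wt hv ?_
    rintro rfl
    exact h0 (map_zero _)
  rcases eq_canonicalCode_or canonicalCode_isSelfDual.permCode h8 hE with h | h
  · exact ⟨φ, h, fun _ _ _ => rfl⟩
  · refine ⟨φ * lastSwap, by rwa [mem_autGroup, ← permCode_permCode], fun z h1 h2 => ?_⟩
    rw [Equiv.Perm.mul_apply, lastSwap, Equiv.swap_apply_of_ne_of_ne h1 h2]

lemma eq_of_agree {σ τ : Equiv.Perm (Fin 44)} (hσ : σ ∈ autGroup canonicalCode)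
    (hτ : τ ∈ autGroup canonicalCode) (hl : ∀ i, σ (leftPt i) = τ (leftPt i))
    (hr : ∀ i, σ (rightPt i) = τ (rightPt i)) : σ = τ := by
  have hρ : τ⁻¹ * σ ∈ autGroup canonicalCode := mul_mem (inv_mem hτ) hσ
  set ρ := τ⁻¹ * σ with hρdef
  have hl' (i) : ρ (leftPt i) = leftPt i := by simp [hρdef, hl]
  have hr' (i) : ρ (rightPt i) = rightPt i := by simp [hρdef, hr]
  have h42 := (apply_last_iff hρ).2 (.inl (rfl : (42 : Fin 44) = 42))
  have h43 := (apply_last_iff hρ).2 (.inr (rfl : (43 : Fin 44) = 43))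
  have hne : ρ 42 ≠ ρ 43 := ρ.injective.ne (by decide)
  have hswap : ρ = 1 ∨ ρ = lastSwap := by
    rcases h42 with h42 | h42
    · have h43 : ρ 43 = 43 := h43.resolve_left fun h => hne (h42.trans h.symm)
      exact .inl (Equiv.ext (forall_coordinates hl' hr' h42 h43))
    · have h43 : ρ 43 = 42 := h43.resolve_right fun h => hne (h42.trans h.symm)
      refine .inr (Equiv.ext (forall_coordinates (fun i => ?_) (fun i => ?_) ?_ ?_))
      · have := leftPt_ne_last i
        rw [hl', lastSwap, Equiv.swap_apply_of_ne_of_ne] <;> tauto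
      · have := rightPt_ne_last i
        rw [hr', lastSwap, Equiv.swap_apply_of_ne_of_ne] <;> tauto
      · rw [h42, lastSwap, Equiv.swap_apply_left]
      · rw [h43, lastSwap, Equiv.swap_apply_right]
  rcases hswap with h | h
  · rw [hρdef, inv_mul_eq_one] at h
    exact h.symm
  · exfalso
    have hmem : vec 44 glueMask ∈ canonicalCode := vec_mem_codeOf (List.mem_cons_self ..)
    have h1 := comp_mem_of_mem_autGroup (h ▸ hρ) hmem
    rw [vec_glueMask_comp_lastSwap] at h1
    have h2 := sub_mem h1 hmem
    rw [add_sub_cancel_left] at h2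
    have := eight_le_wt h2 fun h0 => by have := wt_lastPair; simp [h0, wt] at this
    rw [wt_lastPair] at this
    omega

lemma leftGens_bits : ∀ m ∈ leftGens, pop 44 (m ^^^ lastPair) = 6 ∧ m.testBit 42 = true ∧
    m.testBit 43 = true := by decide +kernel

lemma rightGens_bits : ∀ m ∈ rightGens, pop 44 (m ^^^ lastPair) = 6 ∧ m.testBit 42 = true ∧
    m.testBit 43 = true := by decide +kernel

lemma lastPair_bits :
    (∀ i, vec 44 lastPair (leftPt i) = 0) ∧ (∀ i, vec 44 lastPair (rightPt i) = 0) ∧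
    vec 44 lastPair 42 = 1 ∧ vec 44 lastPair 43 = 1 := by decide +kernel

/-- A weight eight word is recovered from a codeword that agrees with it away from the last two
coordinates. -/
lemma comp_eq_of_agree {m : ℕ} {v : Fin 44 → ZMod 2} {P : Equiv.Perm (Fin 44)}
    (hm : pop 44 (m ^^^ lastPair) = 6 ∧ m.testBit 42 = true ∧ m.testBit 43 = true)
    (hv : v ∈ canonicalCode) (hlast : v 42 = v 43) (h42 : P 42 = 42) (h43 : P 43 = 43)
    (hl : ∀ i, v (P (leftPt i)) = vec 44 m (leftPt i))
    (hr : ∀ i, v (P (rightPt i)) = vec 44 m (rightPt i)) : v ∘ P = vec 44 m := by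
  have hm42 : vec 44 m 42 = 1 := vec_eq_one_iff.2 hm.2.1
  have hm43 : vec 44 m 43 = 1 := vec_eq_one_iff.2 hm.2.2
  obtain ⟨l1, l2, l3, l4⟩ := lastPair_bits
  rcases (by decide : ∀ a : ZMod 2, a = 1 ∨ a = 0) (v 42) with h | h
  · refine funext (forall_coordinates hl hr ?_ ?_)
    · rw [Function.comp_apply, h42, h, hm42]
    · rw [Function.comp_apply, h43, ← hlast, h, hm43]
  · exfalso
    have h6 : v ∘ P = vec 44 (m ^^^ lastPair) := by
      rw [vec_xor]
      refine funext (forall_coordinates (fun i => ?_) (fun i => ?_) ?_ ?_) <;>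
        simp only [Function.comp_apply, Pi.add_apply]
      · rw [hl, l1, add_zero]
      · rw [hr, l2, add_zero]
      · rw [h42, h, hm42, l3]; rfl
      · rw [h43, ← hlast, h, hm43, l4]; rfl
    have hw : wt v = 6 := by rw [← wt_comp (σ := P), h6, wt_vec, hm.1]
    have := eight_le_wt hv (by rintro rfl; simp [wt] at hw)
    omega

lemma exists_aut_of_blocks {g h : Equiv.Perm (Fin 21)} (hg : g ∈ autGroup blockCode)
    (hh : h ∈ autGroup blockCode) : ∃ τ ∈ autGroup canonicalCode,
    (∀ i, τ (leftPt i) = leftPt (g i)) ∧ ∀ i, τ (rightPt i) = rightPt (h i) := by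
  have hlne (i : Fin 21) : leftPt i ≠ 42 ∧ leftPt i ≠ 43 := not_or.1 (leftPt_ne_last i)
  have hrne (i : Fin 21) : rightPt i ≠ 42 ∧ rightPt i ≠ 43 := not_or.1 (rightPt_ne_last i)
  have hinj : Function.Injective (glue (leftPt ∘ g) (rightPt ∘ h) 42 43) :=
    glue_injective (leftPt_injective.comp g.injective) (rightPt_injective.comp h.injective)
      (fun _ _ => leftPt_ne_rightPt _ _) (by decide) (fun _ => (hlne _).1) (fun _ => (hlne _).2)
      (fun _ => (hrne _).1) fun _ => (hrne _).2
  set P : Equiv.Perm (Fin 44) := Equiv.ofBijective _ (Finite.injective_iff_bijective.1 hinj)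
  have hPl (i) : P (leftPt i) = leftPt (g i) := glue_leftPt i
  have hPr (i) : P (rightPt i) = rightPt (h i) := glue_rightPt i
  have hP42 : P 42 = 42 := (Equiv.ofBijective_apply _ _ _).trans glue_42
  have hP43 : P 43 = 43 := (Equiv.ofBijective_apply _ _ _).trans glue_43
  have hE : codeOf 44 evenGens ≤ permCode P canonicalCode := by
    refine codeOf_evenGens_le canonicalCode_isSelfDual.permCode (fun m hm => ?_) fun m hm => ?_
    · have hm' := vec_mem_codeOf (n := 44) hm
      obtain ⟨v, hv, hvb⟩ := mem_blockCode_iff_left.1 (comp_mem_of_mem_autGroup (inv_mem hg)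
        (mem_blockCode_iff_left.2 ⟨_, hm', rfl⟩))
      have hb (i : Fin 21) : v (leftPt (g i)) = vec 44 m (leftPt i) := by
        simpa using congrFun hvb (g i)
      rw [← comp_eq_of_agree (v := v) (P := P) (leftGens_bits m hm) (codeOf_leftGens_le hv)
        (last_eq (codeOf_mono leftGens_subset hv)) hP42 hP43 (fun i => by rw [hPl, hb])
        fun i => by rw [hPr, right_eq_zero hv, right_eq_zero hm']]
      exact comp_mem_permCode.2 (codeOf_leftGens_le hv)
    · have hm' := vec_mem_codeOf (n := 44) hm
      obtain ⟨v, hv, hvb⟩ := mem_blockCode_iff_right.1 (comp_mem_of_mem_autGroup (inv_mem hh)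
        (mem_blockCode_iff_right.2 ⟨_, hm', rfl⟩))
      have hb (i : Fin 21) : v (rightPt (h i)) = vec 44 m (rightPt i) := by
        simpa using congrFun hvb (h i)
      rw [← comp_eq_of_agree (v := v) (P := P) (rightGens_bits m hm) (codeOf_rightGens_le hv)
        (last_eq (codeOf_mono rightGens_subset hv)) hP42 hP43
        (fun i => by rw [hPl, left_eq_zero hv, left_eq_zero hm']) fun i => by rw [hPr, hb]]
      exact comp_mem_permCode.2 (codeOf_rightGens_le hv)
  obtain ⟨τ, hτ, h⟩ := exists_mem_autGroup hE
  exact ⟨τ, hτ, fun i => by rw [h _ (hlne i).1 (hlne i).2, hPl],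
    fun i => by rw [h _ (hrne i).1 (hrne i).2, hPr]⟩

lemma exists_matching_left : ∀ m ∈ leftGens, ∃ m' ∈ rightGens,
    (∀ i, m'.testBit (rightPt i) = m.testBit (leftPt i)) ∧
    (∀ i, m'.testBit (leftPt i) = m.testBit (rightPt i)) := by decide +kernel

lemma exists_matching_right : ∀ m ∈ rightGens, ∃ m' ∈ leftGens,
    (∀ i, m'.testBit (rightPt i) = m.testBit (leftPt i)) ∧
    (∀ i, m'.testBit (leftPt i) = m.testBit (rightPt i)) := by decide +kernel

lemma exists_aut_swapping_blocks : ∃ τ ∈ autGroup canonicalCode,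
    (∀ i, τ (leftPt i) = rightPt i) ∧ ∀ i, τ (rightPt i) = leftPt i := by
  have hlne (i : Fin 21) : leftPt i ≠ 42 ∧ leftPt i ≠ 43 := not_or.1 (leftPt_ne_last i)
  have hrne (i : Fin 21) : rightPt i ≠ 42 ∧ rightPt i ≠ 43 := not_or.1 (rightPt_ne_last i)
  have hinj : Function.Injective (glue rightPt leftPt 42 43) :=
    glue_injective rightPt_injective leftPt_injective (fun _ _ => (leftPt_ne_rightPt _ _).symm)
      (by decide) (fun _ => (hrne _).1) (fun _ => (hrne _).2) (fun _ => (hlne _).1)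
      fun _ => (hlne _).2
  set P : Equiv.Perm (Fin 44) := Equiv.ofBijective _ (Finite.injective_iff_bijective.1 hinj)
  have hPl (i) : P (leftPt i) = rightPt i := glue_leftPt i
  have hPr (i) : P (rightPt i) = leftPt i := glue_rightPt i
  have hP42 : P 42 = 42 := (Equiv.ofBijective_apply _ _ _).trans glue_42
  have hP43 : P 43 = 43 := (Equiv.ofBijective_apply _ _ _).trans glue_43
  have hvec {m m' : ℕ} (h1 : ∀ i, m'.testBit (rightPt i) = m.testBit (leftPt i))
      (h2 : ∀ i, m'.testBit (leftPt i) = m.testBit (rightPt i))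
      (hm : m.testBit 42 = true ∧ m.testBit 43 = true)
      (hm' : m'.testBit 42 = true ∧ m'.testBit 43 = true) : vec 44 m = vec 44 m' ∘ P := by
    refine funext (forall_coordinates (fun i => ?_) (fun i => ?_) ?_ ?_) <;>
      rw [Function.comp_apply]
    · rw [hPl, vec_apply, vec_apply, h1]
    · rw [hPr, vec_apply, vec_apply, h2]
    · rw [hP42, vec_eq_one_iff.2 hm.1, vec_eq_one_iff.2 hm'.1]
    · rw [hP43, vec_eq_one_iff.2 hm.2, vec_eq_one_iff.2 hm'.2]
  have hE : codeOf 44 evenGens ≤ permCode P canonicalCode := by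
    refine codeOf_evenGens_le canonicalCode_isSelfDual.permCode (fun m hm => ?_) fun m hm => ?_
    · obtain ⟨m', hm', h1, h2⟩ := exists_matching_left m hm
      rw [hvec h1 h2 (leftGens_bits m hm).2 (rightGens_bits m' hm').2]
      exact comp_mem_permCode.2 (codeOf_rightGens_le (vec_mem_codeOf hm'))
    · obtain ⟨m', hm', h1, h2⟩ := exists_matching_right m hm
      rw [hvec h1 h2 (rightGens_bits m hm).2 (leftGens_bits m' hm').2]
      exact comp_mem_permCode.2 (codeOf_leftGens_le (vec_mem_codeOf hm'))
  obtain ⟨τ, hτ, h⟩ := exists_mem_autGroup hE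
  exact ⟨τ, hτ, fun i => by rw [h _ (hlne i).1 (hlne i).2, hPl],
    fun i => by rw [h _ (hrne i).1 (hrne i).2, hPr]⟩

lemma exists_blocks_of_aut {σ : Equiv.Perm (Fin 44)} (hσ : σ ∈ autGroup canonicalCode)
    {j : Fin 21} (hj : σ (leftPt 0) = leftPt j) :
    ∃ g ∈ autGroup blockCode, ∃ h ∈ autGroup blockCode,
      (∀ i, σ (leftPt i) = leftPt (g i)) ∧ ∀ i, σ (rightPt i) = rightPt (h i) := by
  have hlast {x : Fin 44} (hx : ¬ (x = 42 ∨ x = 43)) :=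
    exists_leftPt_or_rightPt fun h => hx ((apply_last_iff hσ).1 h)
  have hleft (i : Fin 21) : ∃ k, σ (leftPt i) = leftPt k := by
    refine (hlast (leftPt_ne_last i)).resolve_right ?_
    rintro ⟨k, hk⟩
    have := (linked_apply_iff hσ).2 (linked_left i)
    rw [hj, hk] at this
    exact not_linked _ _ this
  choose g hg using hleft
  have hginj : Function.Injective g := fun a b hab =>
    leftPt_injective (σ.injective (by rw [hg, hg, hab]))
  have hright (i : Fin 21) : ∃ k, σ (rightPt i) = rightPt k := by
    refine (hlast (rightPt_ne_last i)).resolve_left ?_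
    rintro ⟨k, hk⟩
    obtain ⟨i', rfl⟩ := Finite.injective_iff_surjective.1 hginj k
    exact leftPt_ne_rightPt i' i (σ.injective ((hg i').trans hk.symm))
  choose h hh using hright
  have hhinj : Function.Injective h := fun a b hab =>
    rightPt_injective (σ.injective (by rw [hh, hh, hab]))
  refine ⟨Equiv.ofBijective g (Finite.injective_iff_bijective.1 hginj), ?_,
    Equiv.ofBijective h (Finite.injective_iff_bijective.1 hhinj), ?_, hg, hh⟩
  · refine mem_autGroup_of_comp_mem fun b hb => ?_
    obtain ⟨v, hv, rfl⟩ := mem_blockCode_iff_left.1 hb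
    refine mem_blockCode_iff_left.2 ⟨v ∘ σ, mem_left_of_right_eq_zero
      (comp_mem_of_mem_autGroup hσ (codeOf_leftGens_le hv)) fun i => ?_, ?_⟩
    · rw [Function.comp_apply, hh, right_eq_zero hv]
    · exact funext fun i => congrArg v (hg i)
  · refine mem_autGroup_of_comp_mem fun b hb => ?_
    obtain ⟨v, hv, rfl⟩ := mem_blockCode_iff_right.1 hb
    refine mem_blockCode_iff_right.2 ⟨v ∘ σ, mem_right_of_left_eq_zero
      (comp_mem_of_mem_autGroup hσ (codeOf_rightGens_le hv)) fun i => ?_, ?_⟩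
    · rw [Function.comp_apply, hg, left_eq_zero hv]
    · exact funext fun i => congrArg v (hh i)

/-- The automorphism group of the canonical code is a wreath product of that of the block code with
a group of order two; here we only record its order. -/
lemma card_autGroup_canonicalCode :
    Nat.card (autGroup canonicalCode) = 2 * Nat.card (autGroup blockCode) ^ 2 := by
  obtain ⟨w, hw, hwl, hwr⟩ := exists_aut_swapping_blocks
  have key (p : autGroup blockCode × autGroup blockCode) := exists_aut_of_blocks p.1.2 p.2.2
  choose τ hτ hl hr using key
  have hext {p q : autGroup blockCode × autGroup blockCode} (h : τ p = τ q) : p = q := by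
    refine Prod.ext (Subtype.ext (Equiv.ext fun i => leftPt_injective ?_))
      (Subtype.ext (Equiv.ext fun i => rightPt_injective ?_))
    · rw [← hl, ← hl, h]
    · rw [← hr, ← hr, h]
  let F : Bool × (autGroup blockCode × autGroup blockCode) → autGroup canonicalCode :=
    fun p => bif p.1 then ⟨w * τ p.2, mul_mem hw (hτ _)⟩ else ⟨τ p.2, hτ _⟩
  have hinj : Function.Injective F := by
    rintro ⟨_ | _, p⟩ ⟨_ | _, q⟩ h <;> simp only [F, cond_true, cond_false, Subtype.mk.injEq] at h
    · rw [hext h]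
    · have := congrArg (fun σ => σ (leftPt 0)) h
      simp only [Equiv.Perm.mul_apply, hl, hwl] at this
      exact absurd this (leftPt_ne_rightPt _ _)
    · have := congrArg (fun σ => σ (leftPt 0)) h
      simp only [Equiv.Perm.mul_apply, hl, hwl] at this
      exact absurd this.symm (leftPt_ne_rightPt _ _)
    · rw [hext (mul_left_cancel h)]
  have hsurj_left {σ : Equiv.Perm (Fin 44)} (hσ : σ ∈ autGroup canonicalCode) {j : Fin 21}
      (hj : σ (leftPt 0) = leftPt j) : ∃ p, τ p = σ := by
    obtain ⟨g, hg, h, hh, h1, h2⟩ := exists_blocks_of_aut hσ hj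
    exact ⟨⟨⟨g, hg⟩, ⟨h, hh⟩⟩, eq_of_agree (hτ _) hσ (fun i => by rw [hl, h1])
      fun i => by rw [hr, h2]⟩
  have hsurj : Function.Surjective F := by
    rintro ⟨σ, hσ⟩
    rcases exists_leftPt_or_rightPt fun h => leftPt_ne_last 0 ((apply_last_iff hσ).1 h)
      with ⟨j, hj⟩ | ⟨j, hj⟩
    · obtain ⟨p, hp⟩ := hsurj_left hσ hj
      exact ⟨(false, p), Subtype.ext hp⟩
    · obtain ⟨p, hp⟩ := hsurj_left (mul_mem (inv_mem hw) hσ) (j := j) <| by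
        rw [Equiv.Perm.mul_apply, hj, Equiv.Perm.inv_eq_iff_eq, hwl]
      refine ⟨(true, p), Subtype.ext ?_⟩
      change w * τ p = σ
      rw [hp, mul_inv_cancel_left]
  rw [← Nat.card_congr (Equiv.ofBijective F ⟨hinj, hsurj⟩), Nat.card_prod, Nat.card_prod,
    Nat.card_eq_fintype_card, Fintype.card_bool, sq]

end Automorphisms

section BlockAutomorphisms

open Finset

/-- The words of weight six of the block code. -/
def hexadMasks : List ℕ := (spanList blockGens).filter fun m => pop 21 m = 6

/-- Whether some hexad contains all the given points. -/
def covered (l : List (Fin 21)) : Bool := hexadMasks.any fun m => l.all fun x => m.testBit x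

lemma covered_iff {l : List (Fin 21)} :
    covered l = true ↔ ∃ v ∈ blockCode, wt v = 6 ∧ ∀ x ∈ l, v x = 1 := by
  simp only [covered, List.any_eq_true, List.all_eq_true, hexadMasks, List.mem_filter,
    decide_eq_true_eq]
  constructor
  · rintro ⟨m, ⟨hm, h6⟩, h⟩
    exact ⟨_, mem_codeOf.2 ⟨m, hm, rfl⟩, by rw [wt_vec, h6], fun x hx => vec_eq_one_iff.2 (h x hx)⟩
  · rintro ⟨v, hv, h6, h⟩
    obtain ⟨m, hm, rfl⟩ := mem_codeOf.1 hv
    exact ⟨m, ⟨hm, by rwa [wt_vec] at h6⟩, fun x hx => vec_eq_one_iff.1 (h x hx)⟩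

lemma covered_map {σ : Equiv.Perm (Fin 21)} (hσ : σ ∈ autGroup blockCode) (l : List (Fin 21)) :
    covered (l.map σ) = covered l := by
  have key {σ : Equiv.Perm (Fin 21)} (hσ : σ ∈ autGroup blockCode) {l : List (Fin 21)}
      (h : covered (l.map σ) = true) : covered l = true := by
    obtain ⟨v, hv, h6, h⟩ := covered_iff.1 h
    exact covered_iff.2 ⟨_, comp_mem_of_mem_autGroup hσ hv, (wt_comp v).trans h6,
      fun x hx => h _ (List.mem_map_of_mem hx)⟩
  rw [Bool.eq_iff_iff]
  refine ⟨key hσ, fun h => key (inv_mem hσ) ?_⟩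
  simpa [List.map_map, Function.comp_def] using h

/-- The automorphisms of the block code that fix the given points. -/
def blockStab (l : List (Fin 21)) : Subgroup (Equiv.Perm (Fin 21)) where
  carrier := {σ | σ ∈ autGroup blockCode ∧ ∀ x ∈ l, σ x = x}
  one_mem' := ⟨one_mem _, fun _ _ => rfl⟩
  mul_mem' := fun h h' => ⟨mul_mem h.1 h'.1, fun x hx => by
    rw [Equiv.Perm.mul_apply, h'.2 x hx, h.2 x hx]⟩
  inv_mem' := fun h => ⟨inv_mem h.1, fun x hx => Equiv.Perm.inv_eq_iff_eq.2 (h.2 x hx).symm⟩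

lemma mem_blockStab {l : List (Fin 21)} {σ : Equiv.Perm (Fin 21)} :
    σ ∈ blockStab l ↔ σ ∈ autGroup blockCode ∧ ∀ x ∈ l, σ x = x := Iff.rfl

/-- Two points are separated by `l` if some set of points of `l` lies in a hexad with exactly one
of them. -/
def Separated (l : List (Fin 21)) (b w : Fin 21) : Prop :=
  ∃ t ∈ l.sublists, covered (b :: t) ≠ covered (w :: t)

instance (l : List (Fin 21)) (b w : Fin 21) : Decidable (Separated l b w) := by
  unfold Separated; infer_instance

variable {l : List (Fin 21)} {b : Fin 21} {O : Finset (Fin 21)}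

lemma apply_mem_of_separated (hb : b ∈ O) (h : ∀ w, w ∉ O → w ∈ l ∨ Separated l b w)
    {σ : Equiv.Perm (Fin 21)} (hσ : σ ∈ blockStab l) : σ b ∈ O := by
  by_contra hw
  rcases h _ hw with h | ⟨t, ht, h⟩
  · have := σ.injective (hσ.2 _ h)
    rw [this] at hw
    exact hw hb
  · have hmap : t.map σ = t := (List.map_congr_left fun x hx =>
      hσ.2 x ((List.mem_sublists.1 ht).subset hx)).trans (List.map_id t)
    refine h ?_
    rw [← covered_map hσ.1 (b :: t), List.map_cons, hmap]

/-- Coordinate maps preserving the block code. -/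
def blockAuts : List (Fin 21 → Fin 21) :=
  [![0, 1, 3, 2, 4, 5, 6, 8, 7, 10, 9, 11, 12, 20, 19, 17, 18, 15, 16, 14, 13],
   ![0, 1, 4, 3, 2, 5, 7, 6, 8, 18, 20, 17, 19, 16, 14, 15, 13, 11, 9, 12, 10],
   ![0, 1, 2, 3, 4, 9, 10, 11, 12, 5, 6, 7, 8, 17, 18, 19, 20, 13, 14, 15, 16],
   ![0, 19, 12, 14, 5, 1, 17, 18, 20, 11, 15, 7, 2, 10, 4, 13, 8, 9, 6, 3, 16],
   ![6, 0, 13, 20, 11, 1, 5, 7, 8, 17, 15, 4, 12, 10, 18, 2, 14, 3, 19, 16, 9]]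

lemma blockAuts_spec {f : Fin 21 → Fin 21} (hf : f ∈ blockAuts) : Function.Injective f ∧
    ∀ m ∈ blockGens, ∃ m' ∈ hexadMasks, ∀ i : Fin 21, m'.testBit i = m.testBit (f i) := by
  have h : (blockAuts.all fun f => decide (Function.Injective f ∧
      ∀ m ∈ blockGens, ∃ m' ∈ hexadMasks, ∀ i : Fin 21, m'.testBit i = m.testBit (f i))) =
      true := by
    decide +kernel
  exact of_decide_eq_true (List.all_eq_true.1 h f hf)

lemma exists_perm_of_mem_blockAuts {f : Fin 21 → Fin 21} (hf : f ∈ blockAuts) :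
    ∃ σ ∈ autGroup blockCode, ⇑σ = f := by
  obtain ⟨hinj, h⟩ := blockAuts_spec hf
  refine ⟨Equiv.ofBijective f (Finite.injective_iff_bijective.1 hinj), ?_, rfl⟩
  have : blockCode ≤ Submodule.comap
      (permLM (Equiv.ofBijective f (Finite.injective_iff_bijective.1 hinj))) blockCode := by
    refine codeOf_le.2 fun m hm => ?_
    obtain ⟨m', hm', h⟩ := h m hm
    refine mem_codeOf.2 ⟨m', (List.mem_filter.1 hm').1, funext fun i => ?_⟩
    change _ = vec 21 m (f i)
    rw [vec_apply, vec_apply, h]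
  exact mem_autGroup_of_comp_mem this

/-- Adjoin to a set its images under the listed automorphisms that fix `l`. -/
def spread (l : List (Fin 21)) (s : Finset (Fin 21)) : Finset (Fin 21) :=
  s ∪ (blockAuts.filter fun f => ∀ x ∈ l, f x = x).foldr (fun f t => s.image f ∪ t) ∅

lemma exists_apply_eq_of_mem_spread {s : Finset (Fin 21)}
    (hs : ∀ c ∈ s, ∃ σ ∈ blockStab l, σ b = c) :
    ∀ c ∈ spread l s, ∃ σ ∈ blockStab l, σ b = c := by
  intro c hc
  rcases mem_union.1 hc with hc | hc
  · exact hs c hc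
  have key (fs : List (Fin 21 → Fin 21)) (h : c ∈ fs.foldr (fun f t => s.image f ∪ t) ∅) :
      ∃ f ∈ fs, c ∈ s.image f := by
    induction fs with
    | nil => simp at h
    | cons f fs ih =>
      rcases mem_union.1 h with h | h
      · exact ⟨f, List.mem_cons_self .., h⟩
      · obtain ⟨g, hg, h⟩ := ih h
        exact ⟨g, List.mem_cons_of_mem _ hg, h⟩
  obtain ⟨f, hf, hc⟩ := key _ hc
  obtain ⟨d, hd, rfl⟩ := mem_image.1 hc
  rw [List.mem_filter, decide_eq_true_eq] at hf
  obtain ⟨τ, hτ, rfl⟩ := exists_perm_of_mem_blockAuts hf.1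
  obtain ⟨σ, hσ, rfl⟩ := hs d hd
  exact ⟨τ * σ, mul_mem (mem_blockStab.2 ⟨hτ, hf.2⟩) hσ, rfl⟩

/-- One step of the stabiliser chain. -/
lemma card_blockStab (k : ℕ) (hO : (spread l)^[k] {b} = O) (hb : b ∈ O)
    (h : ∀ w, w ∉ O → w ∈ l ∨ Separated l b w) :
    Nat.card (blockStab l) = #O * Nat.card (blockStab (b :: l)) := by
  have htrans (k : ℕ) : ∀ c ∈ (spread l)^[k] {b}, ∃ σ ∈ blockStab l, σ b = c := by
    induction k with
    | zero =>
      intro c hc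
      exact ⟨1, one_mem _, (mem_singleton.1 hc).symm⟩
    | succ k ih =>
      rw [Function.iterate_succ_apply']
      exact exists_apply_eq_of_mem_spread ih
  have ht (c : O) : ∃ σ ∈ blockStab l, σ b = c := htrans k c (hO ▸ c.2)
  choose t ht htb using ht
  let F : O × blockStab (b :: l) → blockStab l := fun p =>
    ⟨t p.1 * p.2.1, mul_mem (ht _) ⟨p.2.2.1, fun x hx => p.2.2.2 x (List.mem_cons_of_mem _ hx)⟩⟩
  have hF (p) : (F p).1 b = p.1 := by
    change t p.1 (p.2.1 b) = _
    rw [p.2.2.2 b (List.mem_cons_self ..), htb]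
  have hinj : Function.Injective F := fun p q hpq => by
    have h1 : p.1 = q.1 := Subtype.ext (by rw [← hF, ← hF, hpq])
    refine Prod.ext h1 (Subtype.ext ?_)
    have := congrArg Subtype.val hpq
    change t p.1 * p.2.1 = t q.1 * q.2.1 at this
    rw [h1] at this
    exact mul_left_cancel this
  have hsurj : Function.Surjective F := by
    rintro ⟨σ, hσ⟩
    set c : O := ⟨σ b, apply_mem_of_separated hb h hσ⟩ with hc
    have hmem : (t c)⁻¹ * σ ∈ blockStab l := mul_mem (inv_mem (ht c)) hσ
    refine ⟨⟨c, ⟨(t c)⁻¹ * σ, hmem.1, fun x hx => ?_⟩⟩, Subtype.ext (mul_inv_cancel_left _ _)⟩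
    rcases List.mem_cons.1 hx with rfl | hx
    · rw [Equiv.Perm.mul_apply, Equiv.Perm.inv_eq_iff_eq, htb]
    · exact hmem.2 x hx
  rw [← Nat.card_congr (Equiv.ofBijective F ⟨hinj, hsurj⟩), Nat.card_prod,
    Nat.card_eq_fintype_card, Fintype.card_coe]

lemma blockStab_eq_bot : blockStab [7, 6, 5, 1, 0] = ⊥ := by
  rw [eq_bot_iff]
  intro σ hσ
  have h8 : σ 8 = 8 := mem_singleton.1 <| apply_mem_of_separated (mem_singleton_self _)
    (by decide +kernel) hσ
  have hσ' : σ ∈ blockStab [8, 7, 6, 5, 1, 0] := ⟨hσ.1, fun x hx => by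
    rcases List.mem_cons.1 hx with rfl | hx
    exacts [h8, hσ.2 x hx]⟩
  have hsep : ∀ z w : Fin 21, w ∉ ({z} : Finset (Fin 21)) →
      z ∈ [8, 7, 6, 5, 1, 0] ∨ w ∈ [8, 7, 6, 5, 1, 0] ∨ Separated [8, 7, 6, 5, 1, 0] z w := by
    decide +kernel
  refine Subgroup.mem_bot.2 (Equiv.ext fun z => ?_)
  by_cases hz : z ∈ [8, 7, 6, 5, 1, 0]
  · exact hσ'.2 z hz
  · exact mem_singleton.1 (apply_mem_of_separated (mem_singleton_self _)
      (fun w hw => (hsep z w hw).resolve_left hz) hσ')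

lemma card_autGroup_blockCode : Nat.card (autGroup blockCode) = 40320 := by
  have h0 : autGroup blockCode = blockStab [] := by
    ext σ
    simp [mem_blockStab]
  rw [h0, card_blockStab (b := 0) (O := univ) 4 (by decide +kernel) (by decide) (by simp),
    card_blockStab (b := 1) (O := univ.erase 0) 4 (by decide +kernel) (by decide)
      (by decide +kernel),
    card_blockStab (b := 5) (O := univ.filter (5 ≤ ·)) 5 (by decide +kernel) (by decide)
      (by decide +kernel),
    card_blockStab (b := 6) (O := {6, 7, 8}) 2 (by decide +kernel) (by decide) (by decide +kernel),
    card_blockStab (b := 7) (O := {7, 8}) 1 (by decide +kernel) (by decide) (by decide +kernel),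
    blockStab_eq_bot, Subgroup.card_bot]
  decide +kernel

end BlockAutomorphisms

section AutomorphismOrder

open Finset

lemma card_autGroup_canonicalCode_eq : Nat.card (autGroup canonicalCode) = 3251404800 := by
  rw [card_autGroup_canonicalCode, card_autGroup_blockCode]; norm_num

lemma targetCode_canonicalCode : targetCode canonicalCode := by
  refine ⟨canonicalCode_isSelfDual, finrank_canonicalCode, minWtEq_canonicalCode, ?_,
    card_canonicalCode_eight, card_canonicalCode_ten⟩
  have := Fact.mk Nat.prime_three
  obtain ⟨σ, hσ⟩ := exists_prime_orderOf_dvd_card' (G := autGroup canonicalCode) 3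
    (by rw [card_autGroup_canonicalCode_eq]; norm_num)
  exact ⟨3, Nat.prime_three, by decide, σ, σ.2, by rwa [Subgroup.orderOf_coe]⟩

/-- Equivalent codes have automorphism groups of the same order. -/
lemma card_autGroup_congr {κ : Type*} {C D : Submodule (ZMod 2) (κ → ZMod 2)} {φ : Equiv.Perm κ}
    (h : permCode φ C = D) : Nat.card (autGroup C) = Nat.card (autGroup D) := by
  have h' := permCode_inv h
  refine Nat.card_congr ((MulAut.conj φ⁻¹).toEquiv.subtypeEquiv fun σ => ?_)
  change permCode σ C = C ↔ permCode (φ⁻¹ * σ * φ⁻¹⁻¹) D = D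
  rw [← permCode_permCode, ← permCode_permCode, h', inv_inv]
  exact ⟨fun hσ => by rw [hσ, h], fun hσ => (permCode_inv hσ).symm.trans h'⟩

end AutomorphismOrder

/-- Up to equivalence there is a unique such code, and its automorphism group has
order 3251404800. -/
theorem sd44_beta_122_unique :
    (∃ Code : Submodule (ZMod 2) (Fin 44 → ZMod 2), targetCode Code) ∧
    (∀ C₁ C₂ : Submodule (ZMod 2) (Fin 44 → ZMod 2),
      targetCode C₁ → targetCode C₂ → codeEquiv C₁ C₂) ∧
    (∀ Code : Submodule (ZMod 2) (Fin 44 → ZMod 2), targetCode Code →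
      Nat.card {σ : Equiv.Perm (Fin 44) // permCode σ Code = Code} = 3251404800) := by
  refine ⟨⟨_, targetCode_canonicalCode⟩, fun C₁ C₂ h₁ h₂ => ?_, fun C hC => ?_⟩
  · obtain ⟨φ₁, h₁⟩ := h₁.exists_equiv
    obtain ⟨φ₂, h₂⟩ := h₂.exists_equiv
    exact ⟨φ₁ * φ₂⁻¹, by rw [← permCode_permCode, h₁, permCode_inv h₂]⟩
  · obtain ⟨φ, h⟩ := hC.exists_equiv
    exact (card_autGroup_congr h).trans card_autGroup_canonicalCode_eq

end SD
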